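/- Let X be a shift of finite type with positive entropy h(X) = log λ. Then for every α with 1/λ < α ≤ 1 and every ε > 0, lim_{n→∞} ℙ(|h(X_ω) − log(αλ)| ≥ ε) = 0, and the convergence is exponential in n: there exist K > 0 and ρ > 0 such that ℙ(|h(X_ω) − log(αλ)| ≥ ε) ≤ K e^{−ρn} for all large n. -/

import Mathlib

open Filter Topology
open scoped Classical

noncomputable section

variable {A : Type*}

/-- The left shift map on bi-infinite sequences over the alphabet `A`. -/
def shiftMap (x : ℤ → A) : ℤ → A := fun i => x (i + 1)

/-- The word `w` of length `n` occurs in the bi-infinite sequence `x`. -/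
def OccursIn {n : ℕ} (w : Fin n → A) (x : ℤ → A) : Prop :=
  ∃ i : ℤ, ∀ j : Fin n, x (i + ((j : ℕ) : ℤ)) = w j

/-- `X` is a shift of finite type: the set of bi-infinite sequences avoiding a
finite set `F` of forbidden words. -/
def IsSFT (X : Set (ℤ → A)) : Prop :=
  ∃ F : Set ((n : ℕ) × (Fin n → A)), F.Finite ∧
    X = {x | ∀ w ∈ F, ¬ OccursIn w.2 x}

/-- `B_n(X)`: the set of words of length `n` appearing in points of `X`. -/
def wordsOf (X : Set (ℤ → A)) (n : ℕ) : Set (Fin n → A) :=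
  {w | ∃ x ∈ X, OccursIn w x}

/-- The length-`n` subword of `x` starting at position `i`. -/
def subword (x : ℤ → A) (i : ℤ) (n : ℕ) : Fin n → A :=
  fun j => x (i + ((j : ℕ) : ℤ))

/-- The random SFT `X_ω`: points of `X` all of whose length-`n` subwords are
allowed by `ω` (a word `w` is allowed iff `ω w = true`). -/
def XRes (X : Set (ℤ → A)) {n : ℕ} (ω : (Fin n → A) → Bool) : Set (ℤ → A) :=
  {x | x ∈ X ∧ ∀ i : ℤ, ω (subword x i n) = true}

/-- The probability of the event `Ev` when each coordinate in `E` is chosen to be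
`true` independently with probability `α` (i.i.d. Bernoulli(α) coins). -/
def bprob {E : Type*} [Fintype E] [DecidableEq E] (α : ℝ) (Ev : Set (E → Bool)) : ℝ :=
  ∑ ω : E → Bool,
    if ω ∈ Ev then
      α ^ (Finset.univ.filter fun e => ω e = true).card *
        (1 - α) ^ (Finset.univ.filter fun e => ω e = false).card
    else 0

/-- `N_p`: the number of points of `X` fixed by the `p`-th power of the shift. -/
def periodicCount (X : Set (ℤ → A)) (p : ℕ) : ℕ :=
  Nat.card {x : ℤ → A // x ∈ X ∧ shiftMap^[p] x = x}

/-- The Artin–Mazur zeta function `ζ_X(t) = exp (∑_{p ≥ 1} N_p t^p / p)`. -/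
def zetaX (X : Set (ℤ → A)) (t : ℝ) : ℝ :=
  Real.exp (∑' p : ℕ, (periodicCount X (p + 1) : ℝ) / (p + 1) * t ^ (p + 1))

end

noncomputable section

variable {A : Type*}

/-- The topological entropy of a subshift, via `h(Y) = inf_n (1/n) log |B_n(Y)|`. -/
def subEntropy (Y : Set (ℤ → A)) : ℝ :=
  ⨅ n : ℕ, Real.log ((wordsOf Y (n + 1)).ncard) / (n + 1)

end

section Coins

variable {E : Type*} [Fintype E]

/-- The Bernoulli(`α`) weight of a configuration of independent coins. -/
def coinWeight (α : ℝ) (ω : E → Bool) : ℝ :=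
  ∏ e, if ω e = true then α else 1 - α

lemma coinWeight_nonneg {α : ℝ} (h0 : 0 ≤ α) (h1 : α ≤ 1) (ω : E → Bool) :
    0 ≤ coinWeight α ω :=
  Finset.prod_nonneg fun e _ => by split_ifs <;> linarith

variable [DecidableEq E]

lemma bprob_eq_sum_coinWeight (α : ℝ) (Ev : Set (E → Bool)) :
    bprob α Ev = ∑ ω : E → Bool, if ω ∈ Ev then coinWeight α ω else 0 := by
  unfold bprob coinWeight
  refine Finset.sum_congr rfl fun ω _ => ?_
  congr 1
  rw [Finset.prod_ite, Finset.prod_const, Finset.prod_const]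
  congr 4
  ext e
  simp

lemma sum_coinWeight_allowed (α : ℝ) (S : Finset E) :
    ∑ ω : E → Bool, coinWeight α ω * (if ∀ e ∈ S, ω e = true then 1 else 0) = α ^ S.card := by
  have h : ∀ ω : E → Bool, coinWeight α ω * (if ∀ e ∈ S, ω e = true then 1 else 0) =
      ∏ e, (if ω e = true then α else if e ∈ S then 0 else 1 - α) := by
    intro ω
    split_ifs with hS
    · rw [mul_one]
      refine Finset.prod_congr rfl fun e _ => ?_
      by_cases he : e ∈ S
      · simp [hS e he]
      · simp [he]
    · push Not at hS
      obtain ⟨e, he, hω⟩ := hS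
      rw [mul_zero]
      exact (Finset.prod_eq_zero (Finset.mem_univ e) (by simp [he, hω])).symm
  simp_rw [h]
  have := Finset.prod_univ_sum (fun _ : E => (Finset.univ : Finset Bool))
    (fun e b => if b = true then α else if e ∈ S then 0 else 1 - α)
  rw [Fintype.piFinset_univ] at this
  rw [← this]
  have h2 : ∀ e : E, (∑ b : Bool, if b = true then α else if e ∈ S then 0 else 1 - α) =
      if e ∈ S then α else 1 := by
    intro e
    by_cases he : e ∈ S <;> simp [he]
  simp_rw [h2]
  simp

lemma sum_coinWeight (α : ℝ) : ∑ ω : E → Bool, coinWeight α ω = 1 := by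
  simpa using sum_coinWeight_allowed (E := E) α ∅

lemma bprob_nonneg {α : ℝ} (h0 : 0 ≤ α) (h1 : α ≤ 1) (Ev : Set (E → Bool)) :
    0 ≤ bprob α Ev := by
  rw [bprob_eq_sum_coinWeight]
  refine Finset.sum_nonneg fun ω _ => ?_
  split_ifs
  · exact coinWeight_nonneg h0 h1 ω
  · exact le_rfl

lemma bprob_mono {α : ℝ} (h0 : 0 ≤ α) (h1 : α ≤ 1) {E₁ E₂ : Set (E → Bool)} (h : E₁ ⊆ E₂) :
    bprob α E₁ ≤ bprob α E₂ := by
  rw [bprob_eq_sum_coinWeight, bprob_eq_sum_coinWeight]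
  refine Finset.sum_le_sum fun ω _ => ?_
  have h3 := coinWeight_nonneg h0 h1 ω
  have h4 := @h ω
  split_ifs <;> first | linarith | tauto

lemma bprob_le_add {α : ℝ} (h0 : 0 ≤ α) (h1 : α ≤ 1) {Ev E₁ E₂ : Set (E → Bool)}
    (h : ∀ ω ∈ Ev, ω ∈ E₁ ∨ ω ∈ E₂) : bprob α Ev ≤ bprob α E₁ + bprob α E₂ := by
  simp only [bprob_eq_sum_coinWeight]
  rw [← Finset.sum_add_distrib]
  refine Finset.sum_le_sum fun ω _ => ?_
  have h3 := coinWeight_nonneg h0 h1 ω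
  have h4 := h ω
  split_ifs <;> first | linarith | tauto

lemma bprob_le_expectation_div {α : ℝ} (h0 : 0 ≤ α) (h1 : α ≤ 1) {Ev : Set (E → Bool)}
    {c : ℝ} (hc : 0 < c) (g : (E → Bool) → ℝ) (hg : ∀ ω, 0 ≤ g ω) (h : ∀ ω ∈ Ev, c ≤ g ω) :
    bprob α Ev ≤ (∑ ω : E → Bool, coinWeight α ω * g ω) / c := by
  rw [le_div_iff₀ hc, bprob_eq_sum_coinWeight, Finset.sum_mul]
  refine Finset.sum_le_sum fun ω _ => ?_
  have h3 := coinWeight_nonneg h0 h1 ω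
  split_ifs with hω
  · exact mul_le_mul_of_nonneg_left (h ω hω) h3
  · rw [zero_mul]; exact mul_nonneg h3 (hg ω)

variable {ι : Type*} (P : Finset ι) (W : ι → Finset E)

/-- The number of indices in `P` all of whose coins show `true`. -/
def survivors (ω : E → Bool) : ℝ :=
  ∑ y ∈ P, if ∀ e ∈ W y, ω e = true then 1 else 0

lemma expectation_survivors (α : ℝ) :
    ∑ ω : E → Bool, coinWeight α ω * survivors P W ω = ∑ y ∈ P, α ^ (W y).card := by
  simp_rw [survivors, Finset.mul_sum]
  rw [Finset.sum_comm]
  exact Finset.sum_congr rfl fun y _ => sum_coinWeight_allowed α (W y)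

lemma expectation_survivors_sq (α : ℝ) :
    ∑ ω : E → Bool, coinWeight α ω * survivors P W ω ^ 2 =
      ∑ x ∈ P, ∑ y ∈ P, α ^ (W x ∪ W y).card := by
  simp_rw [survivors, sq, Finset.sum_mul_sum, Finset.mul_sum]
  rw [Finset.sum_comm]
  refine Finset.sum_congr rfl fun x _ => ?_
  rw [Finset.sum_comm]
  refine Finset.sum_congr rfl fun y _ => ?_
  rw [← sum_coinWeight_allowed α (W x ∪ W y)]
  refine Finset.sum_congr rfl fun ω _ => ?_
  congr 1
  rw [ite_zero_mul_ite_zero, mul_one]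
  refine if_congr ?_ rfl rfl
  simp only [Finset.mem_union]
  constructor
  · rintro ⟨h1, h2⟩ e (h | h)
    exacts [h1 e h, h2 e h]
  · exact fun h => ⟨fun e he => h e (.inl he), fun e he => h e (.inr he)⟩

/-- Chebyshev's inequality for the number of survivors. -/
lemma bprob_survivors_lt_half {α : ℝ} (h0 : 0 ≤ α) (h1 : α ≤ 1) {m v : ℝ}
    (hm : ∑ y ∈ P, α ^ (W y).card = m) (hmpos : 0 < m)
    (hv : ∑ x ∈ P, ∑ y ∈ P with ¬ Disjoint (W x) (W y), α ^ (W x ∪ W y).card ≤ v) :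
    bprob α {ω | survivors P W ω < m / 2} ≤ 4 * v / m ^ 2 := by
  have hsq : ∑ x ∈ P, ∑ y ∈ P, α ^ (W x ∪ W y).card ≤ m ^ 2 + v := by
    have h2 : m ^ 2 = ∑ x ∈ P, ∑ y ∈ P, α ^ (W x).card * α ^ (W y).card := by
      rw [← Finset.sum_mul_sum, hm, sq]
    rw [h2]
    refine le_trans ?_ (add_le_add_right hv _)
    rw [← Finset.sum_add_distrib]
    refine Finset.sum_le_sum fun x _ => ?_
    rw [Finset.sum_filter, ← Finset.sum_add_distrib]
    refine Finset.sum_le_sum fun y _ => ?_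
    split_ifs with hd
    · rw [Finset.card_union_of_disjoint hd, pow_add]; simp
    · have := mul_nonneg (pow_nonneg h0 (W x).card) (pow_nonneg h0 (W y).card)
      linarith
  have hvar : ∑ ω : E → Bool, coinWeight α ω * (survivors P W ω - m) ^ 2 ≤ v := by
    have h3 : ∀ ω : E → Bool, coinWeight α ω * (survivors P W ω - m) ^ 2 =
        coinWeight α ω * survivors P W ω ^ 2 - 2 * m * (coinWeight α ω * survivors P W ω)
          + m ^ 2 * coinWeight α ω := fun ω => by ring
    simp_rw [h3]
    rw [Finset.sum_add_distrib, Finset.sum_sub_distrib, ← Finset.mul_sum, ← Finset.mul_sum,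
      expectation_survivors_sq, expectation_survivors, sum_coinWeight, hm]
    nlinarith
  have h4 := bprob_le_expectation_div h0 h1 (Ev := {ω | survivors P W ω < m / 2})
    (c := m ^ 2 / 4) (by positivity) (fun ω => (survivors P W ω - m) ^ 2)
    (fun ω => sq_nonneg _) (by
      intro ω hω
      have : survivors P W ω < m / 2 := hω
      nlinarith)
  refine h4.trans ?_
  rw [div_div_eq_mul_div, mul_comm]
  gcongr

end Coins

section Counting

lemma sum_le_card_image_mul {Y R : Type*} [DecidableEq R] (T : Finset Y) (r : Y → R)
    (g : Y → ℝ) (b : ℝ) (h : ∀ y₁ ∈ T, ∑ y ∈ T with r y = r y₁, g y ≤ b) :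
    ∑ y ∈ T, g y ≤ (T.image r).card * b := by
  rw [← Finset.sum_fiberwise_of_maps_to (fun y hy => Finset.mem_image_of_mem r hy)]
  rw [← nsmul_eq_mul]
  refine Finset.sum_le_card_nsmul _ _ _ fun c hc => ?_
  obtain ⟨y, hy, rfl⟩ := Finset.mem_image.1 hc
  exact h y hy

lemma sum_union_le_add {Y : Type*} [DecidableEq Y] {g : Y → ℝ} (hg : ∀ y, 0 ≤ g y)
    (S T : Finset Y) : ∑ y ∈ S ∪ T, g y ≤ ∑ y ∈ S, g y + ∑ y ∈ T, g y := by
  rw [← Finset.sum_union_inter]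
  exact le_add_of_nonneg_right (Finset.sum_nonneg fun y _ => hg y)

lemma sum_biUnion_le_sum {Y J : Type*} [DecidableEq Y] {g : Y → ℝ} (hg : ∀ y, 0 ≤ g y)
    (S : Finset J) (T : J → Finset Y) :
    ∑ y ∈ S.biUnion T, g y ≤ ∑ j ∈ S, ∑ y ∈ T j, g y := by
  induction S using Finset.induction_on with
  | empty => simp
  | insert a S ha ih =>
    rw [Finset.biUnion_insert, Finset.sum_insert ha]
    exact (sum_union_le_add hg _ _).trans (add_le_add_right ih _)

variable {A : Type*} {n : ℕ}

/-- The points `x` and `y` agree on the positions `0, …, i - 1`. -/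
def AgreeBelow (i : ℕ) (x y : ℤ → A) : Prop := ∀ j : ℕ, j < i → x j = y j

/-- The length-`n` window of `y` at `j` is neither in `V` nor seen before `j`. -/
def IsNewWindow (V : Finset (Fin n → A)) (y : ℤ → A) (j : ℕ) : Prop :=
  subword y j n ∉ V ∧ ∀ k : ℕ, k < j → subword y j n ≠ subword y k n

/-- The number of new windows of `y` at positions in `[i, q)`. -/
noncomputable def newCount (V : Finset (Fin n → A)) (q i : ℕ) (y : ℤ → A) : ℕ :=
  ((Finset.Ico i q).filter (IsNewWindow V y)).card

/-- The window of `y` at `j` is a repetition, with source `c`. -/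
def RepeatsFrom (j : ℕ) (c : (Fin n → A) ⊕ ℕ) (y : ℤ → A) : Prop :=
  match c with
  | .inl v => subword y j n = v
  | .inr k => k < j ∧ subword y j n = subword y k n

lemma AgreeBelow.extend {i j : ℕ} {x y : ℤ → A} (h : AgreeBelow i x y)
    (h' : subword x i j = subword y i j) : AgreeBelow (i + j) x y := by
  intro k hk
  by_cases hki : k < i
  · exact h k hki
  · have := congrFun h' ⟨k - i, by omega⟩
    have e : (i : ℤ) + ((k - i : ℕ) : ℤ) = k := by omega
    simpa [subword, e] using this

lemma RepeatsFrom.agreeBelow {j : ℕ} {c : (Fin n → A) ⊕ ℕ} {x y : ℤ → A}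
    (hx : RepeatsFrom j c x) (hy : RepeatsFrom j c y) (h : AgreeBelow j x y) :
    AgreeBelow (j + n) x y := by
  match c, hx, hy with
  | .inl v, hx, hy => exact h.extend (Eq.trans hx (Eq.symm hy))
  | .inr k, hx, hy =>
    obtain ⟨hk, hx⟩ := hx
    obtain ⟨-, hy⟩ := hy
    intro a
    induction a using Nat.strong_induction_on with
    | _ a ih =>
      intro ha
      by_cases haj : a < j
      · exact h a haj
      · have h1 := congrFun hx ⟨a - j, by omega⟩
        have h2 := congrFun hy ⟨a - j, by omega⟩
        have e : (j : ℤ) + ((a - j : ℕ) : ℤ) = a := by omega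
        have e' : (k : ℤ) + ((a - j : ℕ) : ℤ) = ((k + (a - j) : ℕ) : ℤ) := by push_cast; ring
        simp only [subword, e, e'] at h1 h2
        rw [h1, h2]
        exact ih _ (by omega) (by omega)

lemma newCount_le_card [DecidableEq A] (V : Finset (Fin n → A)) (q : ℕ) (y : ℤ → A) :
    newCount V q 0 y ≤
      ((Finset.range q).image (fun j : ℕ => subword y j n) \ V).card := by
  refine Finset.card_le_card_of_injOn (fun j : ℕ => subword y j n) ?_ ?_
  · intro j hj
    simp only [Finset.coe_filter, Set.mem_ofPred_eq, Finset.mem_Ico] at hj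
    simp only [Finset.coe_sdiff, Set.mem_sdiff, Finset.mem_coe]
    exact ⟨Finset.mem_image_of_mem _ (Finset.mem_range.2 hj.1.2), hj.2.1⟩
  · intro j hj k hk hjk
    simp only [Finset.coe_filter, Set.mem_ofPred_eq, Finset.mem_Ico] at hj hk
    rcases lt_trichotomy j k with h | h | h
    · exact absurd hjk.symm (hk.2.2 j h)
    · exact h
    · exact absurd hjk (hj.2.2 k h)

lemma newCount_anti (V : Finset (Fin n → A)) (q : ℕ) {i j : ℕ} (hij : i ≤ j) (y : ℤ → A) :
    newCount V q j y ≤ newCount V q i y :=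
  Finset.card_le_card (Finset.filter_subset_filter _ (Finset.Ico_subset_Ico_left hij))

lemma newCount_ge {V : Finset (Fin n → A)} {q i j : ℕ} (hij : i ≤ j) (hjq : j ≤ q)
    {y : ℤ → A} (h : ∀ k, i ≤ k → k < j → IsNewWindow V y k) :
    (j - i) + newCount V q j y ≤ newCount V q i y := by
  unfold newCount
  rw [← Finset.Ico_union_Ico_eq_Ico hij hjq, Finset.filter_union, Finset.card_union_of_disjoint]
  · gcongr
    rw [Finset.filter_true_of_mem, Nat.card_Ico]
    intro k hk
    rw [Finset.mem_Ico] at hk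
    exact h k hk.1 hk.2
  · exact Finset.disjoint_filter_filter (Finset.Ico_disjoint_Ico_consecutive i j q)

lemma exists_first_repeat {V : Finset (Fin n → A)} {q i : ℕ} {y : ℤ → A}
    (h : ¬ ∀ k, i ≤ k → k < q → IsNewWindow V y k) :
    ∃ j ∈ Finset.Ico i q, ∃ c ∈ V.disjSum (Finset.range q), RepeatsFrom j c y ∧
      ∀ k, i ≤ k → k < j → IsNewWindow V y k := by
  push Not at h
  obtain ⟨j, ⟨h1, h2, h3⟩, hfirst⟩ : ∃ j, (i ≤ j ∧ j < q ∧ ¬ IsNewWindow V y j) ∧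
      ∀ k < j, ¬ (i ≤ k ∧ k < q ∧ ¬ IsNewWindow V y k) :=
    ⟨Nat.find h, Nat.find_spec h, fun k => Nat.find_min h⟩
  have hmin : ∀ k, i ≤ k → k < j → IsNewWindow V y k := by
    intro k hik hk
    have := hfirst k hk
    push Not at this
    exact this hik (hk.trans h2)
  refine ⟨j, Finset.mem_Ico.2 ⟨h1, h2⟩, ?_⟩
  unfold IsNewWindow at h3
  rw [not_and_or] at h3
  rcases h3 with h3 | h3
  · exact ⟨.inl (subword y j n), by simpa using h3, rfl, hmin⟩
  · push Not at h3
    obtain ⟨k, hk, hk'⟩ := h3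
    refine ⟨.inr k, ?_, ⟨hk, hk'⟩, hmin⟩
    simp only [Finset.inr_mem_disjSum, Finset.mem_range]
    exact hk.trans h2

variable [Fintype A] [DecidableEq A]

lemma card_image_subword_le {X : Set (ℤ → A)} {T : Finset (ℤ → A)} (hT : ∀ x ∈ T, x ∈ X)
    (i k : ℕ) : (T.image fun y => subword y i k).card ≤ (wordsOf X k).ncard := by
  rw [← Set.ncard_coe_finset]
  refine Set.ncard_le_ncard ?_ (Set.toFinite _)
  intro w hw
  simp only [Finset.coe_image, Set.mem_image, Finset.mem_coe] at hw
  obtain ⟨y, hy, rfl⟩ := hw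
  exact ⟨y, hT y hy, i, fun j => rfl⟩

variable {X : Set (ℤ → A)} {K μ α κ : ℝ} {P : Finset (ℤ → A)} {l q : ℕ}
  {V : Finset (Fin n → A)}

lemma weighted_count_step
    (hB : ∀ k, ((wordsOf X k).ncard : ℝ) ≤ K * μ ^ k) (hα0 : 0 < α) (hα1 : α ≤ 1)
    (hP : ∀ x ∈ P, x ∈ X) {i j : ℕ} (hij : i ≤ j) (hjq : j < q)
    (c : (Fin n → A) ⊕ ℕ) (y₀ : ℤ → A) {b : ℝ} (hb : 0 ≤ b)
    (ih : ∀ y₁, ∑ y ∈ P with AgreeBelow (j + n) y y₁, α ^ newCount V q (j + n) y ≤ b) :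
    ∑ y ∈ P with AgreeBelow i y y₀ ∧ RepeatsFrom j c y ∧
        ∀ k, i ≤ k → k < j → IsNewWindow V y k, α ^ newCount V q i y ≤
      K * (α * μ) ^ (j - i) * b := by
  set T := P.filter fun y => AgreeBelow i y y₀ ∧ RepeatsFrom j c y ∧
        ∀ k, i ≤ k → k < j → IsNewWindow V y k with hTdef
  have h1 := sum_le_card_image_mul T (fun y => subword y i (j - i))
    (fun y => α ^ newCount V q i y) (α ^ (j - i) * b) (by
      intro y₁ hy₁
      calc ∑ y ∈ T with subword y i (j - i) = subword y₁ i (j - i), α ^ newCount V q i y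
          ≤ ∑ y ∈ T with subword y i (j - i) = subword y₁ i (j - i),
              α ^ (j - i) * α ^ newCount V q (j + n) y := by
            refine Finset.sum_le_sum fun y hy => ?_
            rw [← pow_add]
            refine pow_le_pow_of_le_one hα0.le hα1 ?_
            simp only [hTdef, Finset.mem_filter] at hy
            have := newCount_ge (V := V) hij hjq.le hy.1.2.2.2
            have := newCount_anti V q (Nat.le_add_right j n) y
            omega
        _ = α ^ (j - i) * ∑ y ∈ T with subword y i (j - i) = subword y₁ i (j - i),
              α ^ newCount V q (j + n) y := by rw [Finset.mul_sum]
        _ ≤ α ^ (j - i) * b := by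
            refine mul_le_mul_of_nonneg_left (le_trans ?_ (ih y₁)) (by positivity)
            refine Finset.sum_le_sum_of_subset_of_nonneg ?_ fun _ _ _ => by positivity
            intro y hy
            simp only [hTdef, Finset.mem_filter] at hy hy₁ ⊢
            refine ⟨hy.1.1, hy.1.2.2.1.agreeBelow hy₁.2.2.1 ?_⟩
            have h2 : AgreeBelow i y y₁ := fun k hk =>
              (hy.1.2.1 k hk).trans (hy₁.2.1 k hk).symm
            have h3 := h2.extend hy.2
            rwa [Nat.add_sub_cancel' hij] at h3)
  refine h1.trans ?_
  have h2 : ((T.image fun y => subword y i (j - i)).card : ℝ) ≤ K * μ ^ (j - i) :=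
    le_trans (Nat.cast_le.2 (card_image_subword_le
      (fun x hx => hP x (Finset.mem_filter.1 hx).1) i (j - i))) (hB _)
  calc _ ≤ (K * μ ^ (j - i)) * (α ^ (j - i) * b) := by gcongr
    _ = _ := by rw [mul_pow]; ring

/-- Weighted count of the points of `P` by the number of new windows they contain. -/
lemma weighted_count (hK : 1 ≤ K) (hμ : 0 < μ)
    (hB : ∀ k, ((wordsOf X k).ncard : ℝ) ≤ K * μ ^ k) (hα0 : 0 < α) (hα1 : α ≤ 1)
    (hαμ : 1 ≤ α * μ) (hP : ∀ x ∈ P, x ∈ X) (hql : q ≤ l)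
    (hinj : ∀ x ∈ P, ∀ y ∈ P, AgreeBelow l x y → x = y)
    (hκ : K * (1 + q * (V.card + q)) ≤ κ) (s : ℕ) :
    ∀ i, l ≤ i + s * n → ∀ y₀, ∑ y ∈ P with AgreeBelow i y y₀, α ^ newCount V q i y ≤
      κ ^ (s + 1) * (α * μ) ^ (l - i) * (1 / α) ^ (l - q) := by
  have hκ1 : 1 ≤ κ := by
    refine le_trans ?_ hκ
    have : (0 : ℝ) ≤ q * (V.card + q) := by positivity
    nlinarith
  have hα' : 1 ≤ 1 / α := (one_le_div hα0).2 hα1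
  have hwt : ∀ i y, α ^ newCount V q i y ≤ 1 := fun i y => pow_le_one₀ hα0.le hα1
  have hbase : ∀ s i, l ≤ i → ∀ y₀, ∑ y ∈ P with AgreeBelow i y y₀, α ^ newCount V q i y ≤
      κ ^ (s + 1) * (α * μ) ^ (l - i) * (1 / α) ^ (l - q) := by
    intro s i hi y₀
    have hcard : (P.filter fun y => AgreeBelow i y y₀).card ≤ 1 := by
      refine Finset.card_le_one.2 fun x hx y hy => ?_
      rw [Finset.mem_filter] at hx hy
      exact hinj x hx.1 y hy.1 fun j hj =>
        (hx.2 j (hj.trans_le hi)).trans (hy.2 j (hj.trans_le hi)).symm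
    calc _ ≤ ∑ y ∈ P with AgreeBelow i y y₀, (1 : ℝ) := Finset.sum_le_sum fun y _ => hwt i y
      _ ≤ 1 := by simpa using hcard
      _ ≤ _ := one_le_mul_of_one_le_of_one_le (one_le_mul_of_one_le_of_one_le
          (one_le_pow₀ hκ1) (one_le_pow₀ hαμ)) (one_le_pow₀ hα')
  induction s with
  | zero => exact fun i hi => hbase 0 i (by simpa using hi)
  | succ s ih =>
    intro i hi y₀
    by_cases hil : l ≤ i
    · exact hbase _ i hil y₀
    push Not at hil
    set a : ℝ := (1 / α) ^ (l - q) with ha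
    have ha1 : 1 ≤ a := one_le_pow₀ hα'
    set T₀ := P.filter fun y => AgreeBelow i y y₀ ∧ ∀ k, i ≤ k → k < q → IsNewWindow V y k
      with hT₀
    have hnone : ∑ y ∈ T₀, α ^ newCount V q i y ≤ K * (α * μ) ^ (l - i) * a := by
      have h1 := sum_le_card_image_mul T₀ (fun y => subword y i (l - i))
        (fun y => α ^ newCount V q i y) (α ^ (q - i)) (by
          intro y₁ hy₁
          have hcard : (T₀.filter fun y =>
              subword y i (l - i) = subword y₁ i (l - i)).card ≤ 1 := by
            refine Finset.card_le_one.2 fun x hx y hy => ?_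
            simp only [hT₀, Finset.mem_filter] at hx hy
            refine hinj x hx.1.1 y hy.1.1 ?_
            have h2 : AgreeBelow i x y := fun k hk =>
              (hx.1.2.1 k hk).trans (hy.1.2.1 k hk).symm
            have h3 := h2.extend (hx.2.trans hy.2.symm)
            rwa [Nat.add_sub_cancel' hil.le] at h3
          calc _ ≤ ∑ y ∈ T₀ with subword y i (l - i) = subword y₁ i (l - i), α ^ (q - i) := by
                refine Finset.sum_le_sum fun y hy => pow_le_pow_of_le_one hα0.le hα1 ?_
                simp only [hT₀, Finset.mem_filter] at hy
                rcases le_total i q with hiq | hiq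
                · have := newCount_ge (V := V) hiq le_rfl hy.1.2.2
                  omega
                · omega
            _ ≤ 1 * α ^ (q - i) := by
                rw [Finset.sum_const, nsmul_eq_mul]
                gcongr
                exact_mod_cast hcard
            _ = _ := one_mul _)
      refine h1.trans ?_
      have h2 : ((T₀.image fun y => subword y i (l - i)).card : ℝ) ≤ K * μ ^ (l - i) :=
        le_trans (Nat.cast_le.2 (card_image_subword_le
          (fun x hx => hP x (Finset.mem_filter.1 hx).1) i (l - i))) (hB _)
      have h3 : α ^ (q - i) ≤ α ^ (l - i) * a := by
        have h4 : α ^ (l - i) * (1 / α) ^ (l - i) = 1 := by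
          rw [← mul_pow, mul_one_div_cancel hα0.ne', one_pow]
        rcases le_total i q with hiq | hiq
        · have e : l - i = (q - i) + (l - q) := by omega
          rw [ha, e, pow_add, mul_assoc, ← mul_pow, mul_one_div_cancel hα0.ne', one_pow, mul_one]
        · rw [Nat.sub_eq_zero_of_le hiq, pow_zero, ← h4]
          exact mul_le_mul_of_nonneg_left (pow_le_pow_right₀ hα' (by omega)) (by positivity)
      calc _ ≤ (K * μ ^ (l - i)) * (α ^ (l - i) * a) := by gcongr
        _ = _ := by rw [mul_pow]; ring
    have hcover : ∑ y ∈ P with AgreeBelow i y y₀, α ^ newCount V q i y ≤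
        ∑ y ∈ T₀, α ^ newCount V q i y + ∑ j ∈ Finset.Ico i q, ∑ c ∈ V.disjSum (Finset.range q),
          ∑ y ∈ P with AgreeBelow i y y₀ ∧ RepeatsFrom j c y ∧
            ∀ k, i ≤ k → k < j → IsNewWindow V y k, α ^ newCount V q i y := by
      have hsub : (P.filter fun y => AgreeBelow i y y₀) ⊆ T₀ ∪
          (Finset.Ico i q).biUnion fun j => (V.disjSum (Finset.range q)).biUnion fun c =>
            P.filter fun y => AgreeBelow i y y₀ ∧ RepeatsFrom j c y ∧
              ∀ k, i ≤ k → k < j → IsNewWindow V y k := by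
        intro y hy
        rw [Finset.mem_filter] at hy
        by_cases h : ∀ k, i ≤ k → k < q → IsNewWindow V y k
        · exact Finset.mem_union_left _ (Finset.mem_filter.2 ⟨hy.1, hy.2, h⟩)
        · obtain ⟨j, hj, c, hc, h1, h2⟩ := exists_first_repeat h
          refine Finset.mem_union_right _ (Finset.mem_biUnion.2 ⟨j, hj,
            Finset.mem_biUnion.2 ⟨c, hc, Finset.mem_filter.2 ⟨hy.1, hy.2, h1, h2⟩⟩⟩)
      have hnn : ∀ y, 0 ≤ α ^ newCount V q i y := fun y => by positivity
      refine (Finset.sum_le_sum_of_subset_of_nonneg hsub fun y _ _ => hnn y).trans ?_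
      refine (sum_union_le_add hnn _ _).trans (add_le_add_right ?_ _)
      refine (sum_biUnion_le_sum hnn _ _).trans (Finset.sum_le_sum fun j _ => ?_)
      exact sum_biUnion_le_sum hnn _ _
    refine hcover.trans ?_
    have hκ0 : 0 ≤ κ := by linarith
    have hstep : ∀ j ∈ Finset.Ico i q, ∀ c ∈ V.disjSum (Finset.range q),
        ∑ y ∈ P with AgreeBelow i y y₀ ∧ RepeatsFrom j c y ∧
            ∀ k, i ≤ k → k < j → IsNewWindow V y k, α ^ newCount V q i y ≤
          K * κ ^ (s + 1) * (α * μ) ^ (l - i) * a := by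
      intro j hj c _
      rw [Finset.mem_Ico] at hj
      have h1 := weighted_count_step (V := V) hB hα0 hα1 hP hj.1 hj.2 c y₀
        (b := κ ^ (s + 1) * (α * μ) ^ (l - (j + n)) * a) (by positivity)
        (ih (j + n) (by rw [Nat.succ_mul] at hi; omega))
      refine h1.trans ?_
      have h2 : (α * μ) ^ (j - i) * (α * μ) ^ (l - (j + n)) ≤ (α * μ) ^ (l - i) := by
        rw [← pow_add]
        exact pow_le_pow_right₀ hαμ (by omega)
      calc _ = K * κ ^ (s + 1) * ((α * μ) ^ (j - i) * (α * μ) ^ (l - (j + n))) * a := by ring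
        _ ≤ _ := by gcongr
    have hsum := Finset.sum_le_sum fun j hj => Finset.sum_le_sum (hstep j hj)
    simp only [Finset.sum_const, nsmul_eq_mul, Finset.card_disjSum, Finset.card_range,
      Nat.card_Ico] at hsum
    refine (add_le_add hnone hsum).trans ?_
    have hiq : ((q - i : ℕ) : ℝ) ≤ q := by exact_mod_cast Nat.sub_le q i
    set β := (α * μ) ^ (l - i) with hβ
    have hβ0 : 0 < β := by positivity
    calc _ ≤ K * κ ^ (s + 1) * β * a + q * ((V.card + q : ℕ) * (K * κ ^ (s + 1) * β * a)) := by
          gcongr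
          exact le_mul_of_one_le_right (by linarith) (one_le_pow₀ hκ1)
      _ = (K * (1 + q * (V.card + q))) * (κ ^ (s + 1) * β * a) := by push_cast; ring
      _ ≤ κ * (κ ^ (s + 1) * β * a) := by gcongr
      _ = _ := by ring

end Counting

section Windows

variable {A : Type*} [DecidableEq A]

/-- The set of length-`n` windows of `y` at the positions `0, …, q - 1`. -/
def windows (n q : ℕ) (y : ℤ → A) : Finset (Fin n → A) :=
  (Finset.range q).image fun j : ℕ => subword y j n

variable [Fintype A] {n : ℕ} {X : Set (ℤ → A)} {K μ α κ : ℝ} {P : Finset (ℤ → A)} {l q : ℕ}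
  {V : Finset (Fin n → A)}

lemma sum_pow_card_windows_sdiff_le (hK : 1 ≤ K) (hμ : 0 < μ)
    (hB : ∀ k, ((wordsOf X k).ncard : ℝ) ≤ K * μ ^ k) (hα0 : 0 < α) (hα1 : α ≤ 1)
    (hαμ : 1 ≤ α * μ) (hP : ∀ x ∈ P, x ∈ X) (hql : q ≤ l)
    (hinj : ∀ x ∈ P, ∀ y ∈ P, AgreeBelow l x y → x = y)
    (hκ : K * (1 + q * (V.card + q)) ≤ κ) {s : ℕ} (hs : l ≤ s * n) :
    ∑ y ∈ P, α ^ (windows n q y \ V).card ≤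
      κ ^ (s + 1) * (α * μ) ^ l * (1 / α) ^ (l - q) := by
  have hκ0 : 0 ≤ κ := le_trans (by positivity) hκ
  rcases P.eq_empty_or_nonempty with rfl | ⟨y₀, -⟩
  · simp only [Finset.sum_empty]; positivity
  have h := weighted_count hK hμ hB hα0 hα1 hαμ hP hql hinj hκ s 0 (by simpa using hs) y₀
  rw [Finset.filter_true_of_mem (fun y _ k hk => absurd hk (Nat.not_lt_zero k)), Nat.sub_zero] at h
  exact (Finset.sum_le_sum fun y _ =>
    pow_le_pow_of_le_one hα0.le hα1 (newCount_le_card V q y)).trans h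

lemma sum_pow_card_windows_sdiff_le_of_mem (hK : 1 ≤ K) (hμ : 0 < μ)
    (hB : ∀ k, ((wordsOf X k).ncard : ℝ) ≤ K * μ ^ k) (hα0 : 0 < α) (hα1 : α ≤ 1)
    (hαμ : 1 ≤ α * μ) (hP : ∀ x ∈ P, x ∈ X) (hql : q ≤ l)
    (hinj : ∀ x ∈ P, ∀ y ∈ P, AgreeBelow l x y → x = y)
    (hκ : K * (1 + q * (V.card + q)) ≤ κ) {s : ℕ} (hs : l ≤ s * n) :
    ∑ y ∈ P with subword y 0 n ∈ V, α ^ (windows n q y \ V).card ≤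
      V.card * (κ ^ (s + 1) * (α * μ) ^ (l - n) * (1 / α) ^ (l - q)) := by
  have hκ0 : 0 ≤ κ := le_trans (by positivity) hκ
  refine (sum_le_card_image_mul _ (fun y => subword y 0 n) _
    (κ ^ (s + 1) * (α * μ) ^ (l - n) * (1 / α) ^ (l - q)) ?_).trans ?_
  · intro y₁ hy₁
    refine le_trans ?_ (weighted_count hK hμ hB hα0 hα1 hαμ hP hql hinj hκ s n (by omega) y₁)
    refine (Finset.sum_le_sum fun y _ => pow_le_pow_of_le_one hα0.le hα1
      ((newCount_anti V q (Nat.zero_le n) y).trans (newCount_le_card V q y))).trans ?_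
    refine Finset.sum_le_sum_of_subset_of_nonneg ?_ fun _ _ _ => by positivity
    intro y hy
    simp only [Finset.mem_filter] at hy ⊢
    refine ⟨hy.1.1, fun k hk => ?_⟩
    simpa [subword] using congrFun hy.2 ⟨k, hk⟩
  · gcongr
    intro w hw
    obtain ⟨y, hy, rfl⟩ := Finset.mem_image.1 hw
    exact (Finset.mem_filter.1 hy).2

end Windows

section Walks

variable {V : Type*} [Fintype V] [DecidableEq V]

/-- The weighted number of walks of length `L` from `v` that stay inside `S`. -/
noncomputable def walkCount (M : Matrix V V ℝ) (S : Finset V) : ℕ → V → ℝ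
  | 0, v => if v ∈ S then 1 else 0
  | L + 1, v => if v ∈ S then ∑ w, M v w * walkCount M S L w else 0

lemma walkCount_of_notMem (M : Matrix V V ℝ) {S : Finset V} (L : ℕ) {v : V} (hv : v ∉ S) :
    walkCount M S L v = 0 := by
  cases L <;> simp [walkCount, hv]

variable {M : Matrix V V ℝ}

lemma walkCount_nonneg (h0 : ∀ u v, 0 ≤ M u v) (S : Finset V) (L : ℕ) (v : V) :
    0 ≤ walkCount M S L v := by
  induction L generalizing v with
  | zero => unfold walkCount; split_ifs <;> norm_num
  | succ L ih =>
    unfold walkCount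
    split_ifs
    · exact Finset.sum_nonneg fun w _ => mul_nonneg (h0 v w) (ih w)
    · exact le_rfl

lemma matrix_pow_nonneg (h0 : ∀ u v, 0 ≤ M u v) (L : ℕ) (u v : V) : 0 ≤ (M ^ L) u v := by
  induction L generalizing u with
  | zero => rw [pow_zero, Matrix.one_apply]; split_ifs <;> norm_num
  | succ L ih =>
    rw [pow_succ', Matrix.mul_apply]
    exact Finset.sum_nonneg fun w _ => mul_nonneg (h0 u w) (ih w)

/-- Split a walk at its last visit to `u`. -/
lemma walkCount_le_last_visit (h0 : ∀ u v, 0 ≤ M u v) (h1 : ∀ u v, M u v ≤ 1)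
    (S : Finset V) (u : V) (L : ℕ) (v : V) :
    walkCount M S L v ≤ walkCount M (S.erase u) L v + (M ^ L) v u +
      ∑ t ∈ Finset.range L, (M ^ t) v u * ∑ w, walkCount M (S.erase u) (L - 1 - t) w := by
  induction L generalizing v with
  | zero =>
    simp only [walkCount, Finset.mem_erase, pow_zero, Matrix.one_apply, Finset.range_zero,
      Finset.sum_empty, add_zero]
    by_cases hvu : v = u <;> by_cases hv : v ∈ S <;> simp [hvu, hv]
    all_goals split_ifs <;> norm_num
  | succ L ih =>
    set S' := S.erase u with hS'
    have hF := fun L => Finset.sum_nonneg fun w (_ : w ∈ Finset.univ) =>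
      walkCount_nonneg h0 S' L w
    have hrest : 0 ≤ ∑ t ∈ Finset.range L,
        (M ^ (t + 1)) v u * ∑ w, walkCount M S' (L - 1 - t) w :=
      Finset.sum_nonneg fun t _ => mul_nonneg (matrix_pow_nonneg h0 _ _ _) (hF _)
    have hsplit : ∑ t ∈ Finset.range (L + 1), (M ^ t) v u *
        ∑ w, walkCount M S' (L + 1 - 1 - t) w =
        (∑ t ∈ Finset.range L, (M ^ (t + 1)) v u * ∑ w, walkCount M S' (L - 1 - t) w) +
          (M ^ 0) v u * ∑ w, walkCount M S' L w := by
      rw [Finset.sum_range_succ']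
      congr 1
      refine Finset.sum_congr rfl fun t _ => ?_
      rw [show L + 1 - 1 - (t + 1) = L - 1 - t by omega]
    rw [hsplit]
    have hpow := matrix_pow_nonneg h0 (L + 1) v u
    have hone : 0 ≤ (M ^ 0) v u * ∑ w, walkCount M S' L w :=
      mul_nonneg (matrix_pow_nonneg h0 _ _ _) (hF _)
    have hS'0 := walkCount_nonneg h0 S' (L + 1) v
    by_cases hv : v ∈ S
    swap
    · rw [walkCount_of_notMem M _ hv]; linarith
    have hstep : walkCount M S (L + 1) v ≤ ∑ w, M v w * walkCount M S' L w +
        (M ^ (L + 1)) v u +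
          ∑ t ∈ Finset.range L, (M ^ (t + 1)) v u * ∑ w, walkCount M S' (L - 1 - t) w := by
      simp only [walkCount, hv, if_true]
      calc _ ≤ ∑ w, M v w * (walkCount M S' L w + (M ^ L) w u +
            ∑ t ∈ Finset.range L, (M ^ t) w u * ∑ x, walkCount M S' (L - 1 - t) x) :=
          Finset.sum_le_sum fun w _ => mul_le_mul_of_nonneg_left (ih w) (h0 v w)
        _ = _ := by
          simp only [mul_add, Finset.sum_add_distrib, pow_succ', Matrix.mul_apply]
          congr 1
          simp only [Finset.mul_sum, Finset.sum_mul]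
          rw [Finset.sum_comm]
          refine Finset.sum_congr rfl fun t _ => ?_
          rw [Finset.sum_comm]
          refine Finset.sum_congr rfl fun x _ => Finset.sum_congr rfl fun w _ => by ring
    have hcase : ∑ w, M v w * walkCount M S' L w ≤
        walkCount M S' (L + 1) v + (M ^ 0) v u * ∑ w, walkCount M S' L w := by
      by_cases hvu : v = u
      · subst hvu
        rw [pow_zero, Matrix.one_apply_eq, one_mul]
        refine le_trans (Finset.sum_le_sum fun w _ => ?_) (le_add_of_nonneg_left hS'0)
        exact mul_le_of_le_one_left (walkCount_nonneg h0 S' L w) (h1 v w)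
      · have : v ∈ S' := Finset.mem_erase.2 ⟨hvu, hv⟩
        have h2 : walkCount M S' (L + 1) v = ∑ w, M v w * walkCount M S' L w := by
          simp only [walkCount, this, if_true]
        linarith
    linarith

/-- If closed walks grow at most like `ν ^ k`, all walks grow more slowly than any `ν' > ν`. -/
lemma exists_walkCount_le (h0 : ∀ u v, 0 ≤ M u v) (h1 : ∀ u v, M u v ≤ 1) {ν ν' : ℝ}
    (hν : 0 < ν) (hνν' : ν < ν') (hM : ∀ u k, (M ^ k) u u ≤ ν ^ k) (S : Finset V) :
    ∃ C : ℝ, 0 ≤ C ∧ ∀ L, ∑ v, walkCount M S L v ≤ C * ν' ^ L := by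
  induction S using Finset.strongInduction with
  | H S ih =>
    have hex : ∀ u, ∃ C : ℝ, 0 ≤ C ∧ (u ∈ S → ∀ L,
        ∑ v, walkCount M (S.erase u) L v ≤ C * ν' ^ L) := by
      intro u
      by_cases hu : u ∈ S
      · obtain ⟨C, hC, h⟩ := ih _ (Finset.erase_ssubset hu)
        exact ⟨C, hC, fun _ => h⟩
      · exact ⟨0, le_rfl, fun h => absurd h hu⟩
    choose C hC h using hex
    have hd : 0 < ν' - ν := sub_pos.2 hνν'
    refine ⟨∑ u ∈ S, (1 + C u / (ν' - ν)),
      Finset.sum_nonneg fun u _ => by have := hC u; positivity, fun L => ?_⟩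
    have hν' : 0 < ν' := hν.trans hνν'
    rw [Finset.sum_mul, ← Finset.sum_subset (Finset.subset_univ S)
      fun v _ hv => walkCount_of_notMem M L hv]
    refine Finset.sum_le_sum fun u hu => ?_
    have hlast := walkCount_le_last_visit h0 h1 S u L u
    rw [walkCount_of_notMem M L (Finset.notMem_erase u S), zero_add] at hlast
    have hgeom : ∑ t ∈ Finset.range L, ν ^ t * ν' ^ (L - 1 - t) ≤ ν' ^ L / (ν' - ν) := by
      rw [le_div_iff₀ hd]
      have := geom_sum₂_mul ν ν' L
      have := pow_pos hν L
      nlinarith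
    have hsum : ∑ t ∈ Finset.range L, (M ^ t) u u *
        ∑ w, walkCount M (S.erase u) (L - 1 - t) w ≤ C u * (ν' ^ L / (ν' - ν)) := by
      refine le_trans (Finset.sum_le_sum fun t _ => ?_)
        ((Finset.mul_sum _ _ _).symm.trans_le (mul_le_mul_of_nonneg_left hgeom (hC u)))
      have := hC u
      calc _ ≤ ν ^ t * (C u * ν' ^ (L - 1 - t)) :=
            mul_le_mul (hM u t) (h u hu _)
              (Finset.sum_nonneg fun w _ => walkCount_nonneg h0 _ _ w) (by positivity)
        _ = _ := by ring
    have hL : (M ^ L) u u ≤ ν' ^ L := (hM u L).trans (pow_le_pow_left₀ hν.le hνν'.le L)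
    calc _ ≤ ν' ^ L + C u * (ν' ^ L / (ν' - ν)) := by linarith
      _ = _ := by field_simp

lemma matrix_pow_mul_self_ge (h0 : ∀ u v, 0 ≤ M u v) (u : V) (D k : ℕ) :
    ((M ^ D) u u) ^ k ≤ (M ^ (D * k)) u u := by
  induction k with
  | zero => simp
  | succ k ih =>
    rw [Nat.mul_succ, pow_succ, pow_add M, Matrix.mul_apply]
    refine (mul_le_mul_of_nonneg_right ih (matrix_pow_nonneg h0 D u u)).trans ?_
    exact Finset.single_le_sum (f := fun w => (M ^ (D * k)) u w * (M ^ D) w u)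
      (fun w _ => mul_nonneg (matrix_pow_nonneg h0 _ _ _) (matrix_pow_nonneg h0 _ _ _))
      (Finset.mem_univ u)

end Walks

section SFT

variable {A : Type*} {X : Set (ℤ → A)}

lemma subword_mem_wordsOf {x : ℤ → A} (hx : x ∈ X) (i : ℤ) (n : ℕ) :
    subword x i n ∈ wordsOf X n :=
  ⟨x, hx, i, fun _ => rfl⟩

lemma IsSFT.translate_mem (hX : IsSFT X) {x : ℤ → A} (hx : x ∈ X) (k : ℤ) :
    (fun i => x (i + k)) ∈ X := by
  obtain ⟨F, -, rfl⟩ := hX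
  rintro w hw ⟨i, hi⟩
  exact hx w hw ⟨i + k, fun j => by rw [← hi j]; congr 1; ring⟩

lemma IsSFT.exists_mem_of_subword_mem (hX : IsSFT X) :
    ∃ M₀ : ℕ, ∀ n, M₀ ≤ n → ∀ x : ℤ → A,
      (∀ i, subword x i n ∈ wordsOf X n) → x ∈ X := by
  obtain ⟨F, hF, rfl⟩ := hX
  obtain ⟨M₀, hM₀⟩ := (hF.image Sigma.fst).bddAbove
  refine ⟨M₀, fun n hn x hx w hw ⟨i, hi⟩ => ?_⟩
  obtain ⟨x', hx', i', hi'⟩ := hx i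
  have hwn : w.1 ≤ n := (hM₀ ⟨w, hw, rfl⟩).trans hn
  refine hx' w hw ⟨i', fun j => ?_⟩
  rw [← hi j]
  exact hi' ⟨j, j.2.trans_le hwn⟩

/-- The points of `X` that are periodic with period `p`. -/
def perPts (X : Set (ℤ → A)) (p : ℕ) : Set (ℤ → A) :=
  {x | x ∈ X ∧ Function.Periodic x (p : ℤ)}

lemma apply_emod_of_periodic {x : ℤ → A} {p : ℤ} (hx : Function.Periodic x p) (i : ℤ) :
    x (i % p) = x i := by
  conv_rhs => rw [← Int.emod_add_ediv_mul i p]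
  exact (hx.int_mul _ _).symm

lemma AgreeBelow.eq_of_periodic {p : ℕ} (hp : p ≠ 0) {x y : ℤ → A}
    (hx : Function.Periodic x (p : ℤ)) (hy : Function.Periodic y (p : ℤ))
    (h : AgreeBelow p x y) : x = y := by
  funext i
  have hp' : (p : ℤ) ≠ 0 := by exact_mod_cast hp
  have h0 := Int.emod_nonneg i hp'
  have h1 := Int.emod_lt_of_pos i (by omega : (0 : ℤ) < p)
  rw [← apply_emod_of_periodic hx, ← apply_emod_of_periodic hy]
  have := h (i % p).toNat (by omega)
  rwa [Int.toNat_of_nonneg h0] at this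

lemma finite_perPts [Finite A] (X : Set (ℤ → A)) {p : ℕ} (hp : p ≠ 0) : (perPts X p).Finite := by
  refine Set.Finite.of_finite_image (f := fun x => subword x 0 p) (Set.toFinite _) ?_
  intro x hx y hy hxy
  refine AgreeBelow.eq_of_periodic hp hx.2 hy.2 fun j hj => ?_
  simpa [subword] using congrFun hxy ⟨j, hj⟩

/-- Every word of `X` occurs at the origin of a point of a suitable finite subset of `X`. -/
lemma IsSFT.exists_finset_represents [Finite A] (hX : IsSFT X) (m : ℕ) :
    ∃ P : Finset (ℤ → A), (∀ x ∈ P, x ∈ X) ∧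
      (∀ x ∈ P, ∀ y ∈ P, AgreeBelow m x y → x = y) ∧
      ∀ w ∈ wordsOf X m, ∃ x ∈ P, subword x 0 m = w := by
  have h : ∀ w : wordsOf X m, ∃ x ∈ X, subword x 0 m = w := by
    rintro ⟨w, x, hx, i, hi⟩
    refine ⟨_, hX.translate_mem hx i, funext fun j => ?_⟩
    refine Eq.trans ?_ (hi j)
    simp only [subword]
    congr 1
    ring
  have := Fintype.ofFinite (wordsOf X m)
  choose f hfX hf using h
  refine ⟨Finset.univ.image f, ?_, ?_, fun w hw => ⟨f ⟨w, hw⟩, by simp, hf _⟩⟩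
  · intro x hx
    obtain ⟨w, -, rfl⟩ := Finset.mem_image.1 hx
    exact hfX w
  · intro x hx y hy hxy
    obtain ⟨w, -, rfl⟩ := Finset.mem_image.1 hx
    obtain ⟨w', -, rfl⟩ := Finset.mem_image.1 hy
    congr 1
    ext1
    rw [← hf w, ← hf w']
    funext j
    simpa [subword] using hxy j j.2

end SFT

section HigherBlock

variable {A : Type*} {X : Set (ℤ → A)} {M : ℕ}

/-- The adjacency matrix of the graph whose vertices are the words of length `M`. -/
noncomputable def blockAdj (X : Set (ℤ → A)) (M : ℕ) : Matrix (Fin M → A) (Fin M → A) ℝ :=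
  fun u v => if u ∈ wordsOf X M ∧ ∀ (i : ℕ) (h : i + 1 < M), u ⟨i + 1, h⟩ = v ⟨i, by omega⟩
    then 1 else 0

lemma blockAdj_nonneg (u v : Fin M → A) : 0 ≤ blockAdj X M u v := by
  unfold blockAdj; split_ifs <;> norm_num

lemma blockAdj_le_one (u v : Fin M → A) : blockAdj X M u v ≤ 1 := by
  unfold blockAdj; split_ifs <;> norm_num

variable [Fintype A] [DecidableEq A]

/-- The words of length `M + L` of `X` with prefix `u`. -/
noncomputable def wordsFrom (X : Set (ℤ → A)) (M L : ℕ) (u : Fin M → A) :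
    Finset (Fin (M + L) → A) :=
  {w | w ∈ wordsOf X (M + L) ∧ ∀ j : Fin M, w ⟨j, by omega⟩ = u j}

lemma card_wordsFrom_le (hM : 0 < M) (L : ℕ) (u : Fin M → A) :
    ((wordsFrom X M L u).card : ℝ) ≤ walkCount (blockAdj X M) Finset.univ L u := by
  induction L generalizing u with
  | zero =>
    simp only [walkCount, Finset.mem_univ, if_true]
    have : (wordsFrom X M 0 u).card ≤ 1 := by
      rw [Finset.card_le_one]
      intro w hw w' hw'
      simp only [wordsFrom, Finset.mem_filter, Finset.mem_univ, true_and] at hw hw'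
      funext j
      exact (hw.2 ⟨j, j.2⟩).trans (hw'.2 ⟨j, j.2⟩).symm
    exact_mod_cast this
  | succ L ih =>
    simp only [walkCount, Finset.mem_univ, if_true]
    rw [Finset.card_eq_sum_card_fiberwise (t := Finset.univ)
      (f := fun w (j : Fin M) => w ⟨j + 1, by omega⟩) fun _ _ => by simp]
    push_cast
    refine Finset.sum_le_sum fun v _ => ?_
    refine le_trans ?_ (mul_le_mul_of_nonneg_left (ih v) (blockAdj_nonneg u v))
    rcases Finset.eq_empty_or_nonempty {w ∈ wordsFrom X M (L + 1) u |
      (fun j : Fin M => w ⟨j + 1, by omega⟩) = v} with he | ⟨w₀, hw₀⟩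
    · rw [he]
      simpa using mul_nonneg (blockAdj_nonneg u v) (Nat.cast_nonneg _)
    · simp only [wordsFrom, Finset.mem_filter, Finset.mem_univ, true_and] at hw₀
      obtain ⟨⟨⟨x, hx, i, hi⟩, hu⟩, hv⟩ := hw₀
      have hadj : blockAdj X M u v = 1 := by
        refine if_pos ⟨⟨x, hx, i, fun j => ?_⟩, fun j h => ?_⟩
        · rw [← hu j, ← hi]
        · rw [← hu, ← hv]
      rw [hadj, one_mul]
      norm_cast
      refine Finset.card_le_card_of_injOn (fun w (j : Fin (M + L)) => w ⟨j + 1, by omega⟩) ?_ ?_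
      · intro w hw
        simp only [wordsFrom, Finset.coe_filter, Finset.mem_filter, Finset.mem_univ, true_and,
          Set.mem_ofPred_eq] at hw ⊢
        obtain ⟨⟨⟨x, hx, i, hi⟩, hu⟩, hv⟩ := hw
        refine ⟨⟨x, hx, i + 1, fun j => ?_⟩, fun j => congrFun hv j⟩
        simp only [← hi]
        congr 1
        push_cast
        ring
      · intro w hw w' hw' h
        simp only [wordsFrom, Finset.coe_filter, Finset.mem_filter, Finset.mem_univ, true_and,
          Set.mem_ofPred_eq] at hw hw'
        funext j
        obtain ⟨_ | j, hj⟩ := j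
        · exact (hw.1.2 ⟨0, hM⟩).trans (hw'.1.2 ⟨0, hM⟩).symm
        · exact congrFun h ⟨j, by omega⟩

lemma ncard_wordsOf_le_sum_walkCount (hM : 0 < M) (L : ℕ) :
    ((wordsOf X (M + L)).ncard : ℝ) ≤
      ∑ u, walkCount (blockAdj X M) Finset.univ L u := by
  refine le_trans ?_ (Finset.sum_le_sum fun u _ => card_wordsFrom_le hM L u)
  rw [Set.ncard_eq_toFinset_card', Finset.card_eq_sum_card_fiberwise (t := Finset.univ)
      (f := fun w (j : Fin M) => w ⟨j, by omega⟩) fun _ _ => by simp]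
  push_cast
  refine Finset.sum_le_sum fun u _ => ?_
  norm_cast
  refine Finset.card_le_card fun w hw => ?_
  simp only [Finset.mem_filter, Set.mem_toFinset] at hw
  simpa [wordsFrom] using ⟨hw.1, fun j => congrFun hw.2 j⟩

/-- The words of length `M + L` with prefix `u` and suffix `v`, all of whose windows of length `M`
but the last are words of `X`. -/
noncomputable def blockPaths (X : Set (ℤ → A)) (M L : ℕ) (u v : Fin M → A) :
    Finset (Fin (M + L) → A) :=
  {w | (∀ j : Fin M, w ⟨j, by omega⟩ = u j) ∧ (∀ j : Fin M, w ⟨L + j, by omega⟩ = v j) ∧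
    ∀ (i : ℕ) (h : i < L), (fun j : Fin M => w ⟨i + j, by omega⟩) ∈ wordsOf X M}

lemma blockAdj_pow_le (hM : 0 < M) (L : ℕ) (u v : Fin M → A) :
    (blockAdj X M ^ L) u v ≤ (blockPaths X M L u v).card := by
  induction L generalizing u with
  | zero =>
    rw [pow_zero, Matrix.one_apply]
    split_ifs with h
    · have : 0 < (blockPaths X M 0 u v).card := by
        refine Finset.card_pos.2 ⟨fun j => u j, ?_⟩
        simp [blockPaths, h]
      exact_mod_cast this
    · exact Nat.cast_nonneg _
  | succ L ih =>
    rw [pow_succ', Matrix.mul_apply, Finset.card_eq_sum_card_fiberwise (t := Finset.univ)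
      (f := fun w (j : Fin M) => w ⟨j + 1, by omega⟩) fun _ _ => by simp]
    push_cast
    refine Finset.sum_le_sum fun t _ => ?_
    refine le_trans (mul_le_mul_of_nonneg_left (ih t) (blockAdj_nonneg u t)) ?_
    by_cases hut : u ∈ wordsOf X M ∧ ∀ (i : ℕ) (h : i + 1 < M), u ⟨i + 1, h⟩ = t ⟨i, by omega⟩
    swap
    · rw [show blockAdj X M u t = 0 from if_neg hut, zero_mul]
      exact Nat.cast_nonneg _
    rw [show blockAdj X M u t = 1 from if_pos hut, one_mul]
    norm_cast
    refine Finset.card_le_card_of_injOn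
      (fun w => (Fin.cons (u ⟨0, hM⟩) w : Fin (M + L + 1) → A)) ?_ fun w _ w' _ h =>
        (Fin.cons_injective2 h).2
    intro w hw
    simp only [blockPaths, Finset.coe_filter, Finset.mem_filter, Finset.mem_univ, true_and,
      Set.mem_ofPred_eq] at hw ⊢
    obtain ⟨hp, hs, hwin⟩ := hw
    have hc : ∀ (i : ℕ) (h : i + 1 < M + L + 1),
        (Fin.cons (u ⟨0, hM⟩) w : Fin (M + L + 1) → A) ⟨i + 1, h⟩ = w ⟨i, by omega⟩ :=
      fun i h => rfl
    have hpre : ∀ j : Fin M,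
        (Fin.cons (u ⟨0, hM⟩) w : Fin (M + L + 1) → A) ⟨j, by omega⟩ = u j := by
      rintro ⟨_ | j, hj⟩
      · rfl
      · rw [hc, hut.2 j hj, ← hp]
    refine ⟨⟨hpre, fun j => ?_, fun i h => ?_⟩, ?_⟩
    · rw [← hs j]
      convert hc (L + j) (by omega) using 3 <;> omega
    · rcases i with _ | i
      · convert hut.1 using 1
        funext j
        rw [← hpre j]
        congr 2
        omega
      · convert hwin i (by omega) using 1
        funext j
        convert hc (i + j) (by omega) using 3 <;> omega
    · funext j
      rw [hc, ← hp]

lemma card_blockPaths_le_perPts (hX : ∀ x : ℤ → A, (∀ i, subword x i M ∈ wordsOf X M) → x ∈ X)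
    {p : ℕ} (hp : p ≠ 0) (u : Fin M → A) :
    (blockPaths X M p u u).card ≤ (perPts X p).ncard := by
  have hp' : (p : ℤ) ≠ 0 := by exact_mod_cast hp
  have h0 := fun i => Int.emod_nonneg i hp'
  have h1 := fun i => Int.emod_lt_of_pos i (by omega : (0 : ℤ) < p)
  let f : (Fin (M + p) → A) → ℤ → A := fun w i =>
    w ⟨(i % p).toNat, by have := h0 i; have := h1 i; omega⟩
  have hper : ∀ w, Function.Periodic (f w) (p : ℤ) := fun w i => by
    simp only [f, Int.add_emod_right]
  have hf : ∀ w ∈ blockPaths X M p u u, ∀ (k : ℕ) (h : k < M + p), f w k = w ⟨k, h⟩ := by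
    intro w hw k
    simp only [blockPaths, Finset.mem_filter, Finset.mem_univ, true_and] at hw
    induction k using Nat.strong_induction_on with
    | _ k ih =>
      intro h
      rcases lt_or_ge k p with hk | hk
      · simp only [f]
        congr 2
        rw [Int.emod_eq_of_lt (by omega) (by omega)]
        simp
      · have h2 := ih (k - p) (by omega) (by omega)
        have h3 := hw.1 ⟨k - p, by omega⟩
        have h4 := hw.2.1 ⟨k - p, by omega⟩
        have h5 := hper w ((k - p : ℕ) : ℤ)
        rw [show ((k - p : ℕ) : ℤ) + p = k by omega] at h5
        rw [h5, h2, h3, ← h4]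
        congr 2
        simp only
        omega
  rw [← Set.ncard_coe_finset]
  refine Set.ncard_le_ncard_of_injOn f (fun w hw => ⟨hX _ fun i => ?_, hper w⟩) ?_
    (finite_perPts X hp)
  · have hw' := hw
    simp only [blockPaths, Finset.coe_filter, Finset.mem_univ, true_and,
      Set.mem_ofPred_eq] at hw'
    have h0i := h0 i
    have h1i := h1 i
    convert hw'.2.2 (i % p).toNat (by omega) using 1
    funext j
    rw [← hf w hw, subword, ← apply_emod_of_periodic (hper w),
      ← apply_emod_of_periodic (hper w) (((i % p).toNat + j : ℕ) : ℤ)]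
    push_cast
    rw [Int.toNat_of_nonneg h0i, Int.emod_add_emod]
  · intro w hw w' hw' h
    funext ⟨k, hk⟩
    rw [← hf w hw k hk, ← hf w' hw' k hk, h]

end HigherBlock

section Growth

variable {A : Type*} {X : Set (ℤ → A)} {lam : ℝ}

lemma eventually_pow_lt_ncard_wordsOf
    (hent : Tendsto (fun n : ℕ => Real.log ((wordsOf X n).ncard) / (n : ℝ)) atTop
      (𝓝 (Real.log lam))) {ν : ℝ} (hν : 1 ≤ ν) (hνl : ν < lam) :
    ∀ᶠ n : ℕ in atTop, ν ^ n < (wordsOf X n).ncard := by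
  filter_upwards [hent.eventually_const_lt (Real.log_lt_log (by linarith) hνl),
    eventually_gt_atTop 0] with n hn hn0
  have hn0' : (0 : ℝ) < n := by exact_mod_cast hn0
  rw [lt_div_iff₀ hn0', mul_comm, ← Real.log_pow] at hn
  have hlog : 0 ≤ Real.log (ν ^ n) := Real.log_nonneg (one_le_pow₀ hν)
  refine (Real.log_lt_log_iff (by positivity) ?_).1 hn
  refine (Nat.cast_nonneg _).lt_of_ne fun h => ?_
  rw [← h, Real.log_zero] at hn
  linarith

lemma exists_ncard_wordsOf_le [Finite A] (hlam : 1 < lam)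
    (hent : Tendsto (fun n : ℕ => Real.log ((wordsOf X n).ncard) / (n : ℝ)) atTop
      (𝓝 (Real.log lam))) {μ : ℝ} (hμ : lam < μ) :
    ∃ K : ℝ, 1 ≤ K ∧ ∀ k, ((wordsOf X k).ncard : ℝ) ≤ K * μ ^ k := by
  have hev : ∀ᶠ n : ℕ in atTop, ((wordsOf X n).ncard : ℝ) ≤ μ ^ n := by
    filter_upwards [hent.eventually_lt_const (Real.log_lt_log (by linarith) hμ),
      eventually_gt_atTop 0] with n hn hn0
    have hn0' : (0 : ℝ) < n := by exact_mod_cast hn0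
    have hμ0 : 0 < μ := by linarith
    rcases (Nat.cast_nonneg (α := ℝ) (wordsOf X n).ncard).eq_or_lt with h | h
    · rw [← h]; positivity
    · rw [div_lt_iff₀ hn0', mul_comm, ← Real.log_pow] at hn
      exact ((Real.log_lt_log_iff h (by positivity)).1 hn).le
  obtain ⟨N, hN⟩ := eventually_atTop.1 hev
  have hs : 0 ≤ ∑ k ∈ Finset.range N, ((wordsOf X k).ncard : ℝ) :=
    Finset.sum_nonneg fun _ _ => Nat.cast_nonneg _
  refine ⟨1 + ∑ k ∈ Finset.range N, ((wordsOf X k).ncard : ℝ), by linarith, fun k => ?_⟩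
  have h1 : 1 ≤ μ ^ k := one_le_pow₀ (by linarith)
  rcases lt_or_ge k N with hk | hk
  · have : ((wordsOf X k).ncard : ℝ) ≤ ∑ k ∈ Finset.range N, ((wordsOf X k).ncard : ℝ) :=
      Finset.single_le_sum (f := fun k => ((wordsOf X k).ncard : ℝ))
        (fun _ _ => Nat.cast_nonneg _) (Finset.mem_range.2 hk)
    nlinarith
  · have := hN k hk
    nlinarith

/-- Along a suitable arithmetic progression, periodic points grow almost as fast as words. -/
lemma IsSFT.exists_le_ncard_perPts [Fintype A] [DecidableEq A] (hX : IsSFT X)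
    (hent : Tendsto (fun n : ℕ => Real.log ((wordsOf X n).ncard) / (n : ℝ)) atTop
      (𝓝 (Real.log lam))) {ν : ℝ} (hν : 1 ≤ ν) (hνl : ν < lam) :
    ∃ D : ℕ, 0 < D ∧ ∀ k, 0 < k → ν ^ (D * k) ≤ (perPts X (D * k)).ncard := by
  obtain ⟨M₀, hM₀⟩ := hX.exists_mem_of_subword_mem
  set M := M₀ + 1
  have hM : 0 < M := Nat.succ_pos _
  have h0 : ∀ u v, 0 ≤ blockAdj X M u v := blockAdj_nonneg
  by_cases hcase : ∃ u D, ν ^ D < (blockAdj X M ^ D) u u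
  · obtain ⟨u, D, hD⟩ := hcase
    have hDpos : 0 < D := by
      rcases Nat.eq_zero_or_pos D with rfl | h
      · simp at hD
      · exact h
    refine ⟨D, hDpos, fun k hk => ?_⟩
    rw [pow_mul]
    calc (ν ^ D) ^ k ≤ ((blockAdj X M ^ D) u u) ^ k :=
          pow_le_pow_left₀ (by positivity) hD.le k
      _ ≤ (blockAdj X M ^ (D * k)) u u := matrix_pow_mul_self_ge h0 u D k
      _ ≤ (blockPaths X M (D * k) u u).card := blockAdj_pow_le hM _ u u
      _ ≤ _ := by
        exact_mod_cast card_blockPaths_le_perPts (hM₀ M (Nat.le_succ _))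
          (Nat.mul_pos hDpos hk).ne' u
  · push Not at hcase
    exfalso
    obtain ⟨a, hνa, hal⟩ := exists_between hνl
    obtain ⟨b, hab, hbl⟩ := exists_between hal
    obtain ⟨C, -, hC⟩ := exists_walkCount_le h0 blockAdj_le_one (by linarith) hνa hcase Finset.univ
    have ha0 : 0 < a := by linarith
    have hev := (tendsto_add_atTop_nat M).eventually
      (eventually_pow_lt_ncard_wordsOf hent (by linarith : 1 ≤ b) hbl)
    have hbig := (tendsto_pow_atTop_atTop_of_one_lt ((one_lt_div ha0).2 hab)).eventually_ge_atTop C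
    obtain ⟨L, h1, h2⟩ := (hev.and hbig).exists
    have h3 := (ncard_wordsOf_le_sum_walkCount (X := X) hM L).trans (hC L)
    rw [add_comm] at h1
    rw [div_pow, le_div_iff₀ (by positivity)] at h2
    have h4 : b ^ L ≤ b ^ (M + L) := pow_le_pow_right₀ (by linarith) (by omega)
    linarith

end Growth

section Entropy

variable {A : Type*} {X : Set (ℤ → A)} {n p : ℕ}

lemma subEntropy_le (Y : Set (ℤ → A)) {m : ℕ} (hm : 0 < m) :
    subEntropy Y ≤ Real.log ((wordsOf Y m).ncard) / m := by
  obtain ⟨k, rfl⟩ := Nat.exists_eq_succ_of_ne_zero hm.ne'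
  have hbdd : BddBelow (Set.range fun k : ℕ =>
      Real.log ((wordsOf Y (k + 1)).ncard) / ((k : ℝ) + 1)) := by
    refine ⟨0, ?_⟩
    rintro _ ⟨k, rfl⟩
    exact div_nonneg (Real.log_natCast_nonneg _) (by positivity)
  refine (ciInf_le hbdd k).trans_eq ?_
  push_cast
  rfl

lemma ncard_wordsOf_add_le [Finite A] (Y : Set (ℤ → A)) (a b : ℕ) :
    (wordsOf Y (a + b)).ncard ≤ (wordsOf Y a).ncard * (wordsOf Y b).ncard := by
  rw [← Set.ncard_prod]
  refine Set.ncard_le_ncard_of_injOn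
    (fun w => (fun j => w (Fin.castAdd b j), fun j => w (Fin.natAdd a j))) ?_ ?_ (Set.toFinite _)
  · rintro w ⟨y, hy, i, hi⟩
    refine ⟨⟨y, hy, i, fun j => hi (Fin.castAdd b j)⟩, ⟨y, hy, i + a, fun j => ?_⟩⟩
    simp only [← hi (Fin.natAdd a j), Fin.val_natAdd]
    push_cast
    rw [add_assoc]
  · intro w _ w' _ h
    simp only [Prod.mk.injEq] at h
    funext j
    exact Fin.addCases (fun j => congrFun h.1 j) (fun j => congrFun h.2 j) j

lemma ncard_wordsOf_mul_le [Finite A] (Y : Set (ℤ → A)) (m k : ℕ) :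
    (wordsOf Y (m * k)).ncard ≤ (wordsOf Y m).ncard ^ k := by
  induction k with
  | zero =>
    rw [Nat.mul_zero, pow_zero]
    exact Set.ncard_le_one_of_subsingleton _
  | succ k ih =>
    rw [Nat.mul_succ, pow_succ]
    exact (ncard_wordsOf_add_le Y _ _).trans (Nat.mul_le_mul_right _ ih)

/-- The concatenation of the blocks `g t` on `[0, p)`, the block `g t` being placed at `t * p`. -/
def concat (p : ℕ) (g : ℤ → ℤ → A) : ℤ → A := fun i => g (i / p) (i % p)

lemma concat_apply (hp : 0 < p) (g : ℤ → ℤ → A) (t : ℤ) {j : ℕ} (hj : j < p) :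
    concat p g (t * p + j) = g t j := by
  have hp' : (p : ℤ) ≠ 0 := by omega
  have h1 : (t * p + j) / p = t := by
    rw [add_comm, Int.add_mul_ediv_right _ _ hp', Int.ediv_eq_zero_of_lt (by omega) (by omega),
      zero_add]
  have h2 : (t * p + j) % p = j := by
    rw [add_comm, Int.add_mul_emod_self_right, Int.emod_eq_of_lt (by omega) (by omega)]
  rw [concat, h1, h2]

lemma subword_concat (hp : 0 < p) (hnp : n ≤ p) {Z : Set (ℤ → A)} {u : Fin n → A}
    (hper : ∀ z ∈ Z, Function.Periodic z (p : ℤ)) (hu : ∀ z ∈ Z, subword z 0 n = u)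
    {g : ℤ → ℤ → A} (hg : ∀ t, g t ∈ Z) (i : ℤ) :
    ∃ z ∈ Z, ∃ r : ℤ, subword (concat p g) i n = subword z r n := by
  have hp' : (p : ℤ) ≠ 0 := by omega
  have h0 := Int.emod_nonneg i hp'
  have h1 := Int.emod_lt_of_pos i (by omega : (0 : ℤ) < p)
  set t := i / p
  obtain ⟨r, hr⟩ := Int.eq_ofNat_of_zero_le h0
  have hi : i = t * p + r := by
    rw [← hr]
    exact (Int.ediv_mul_add_emod i p).symm
  refine ⟨g t, hg t, r, funext fun j => ?_⟩
  simp only [subword]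
  rcases lt_or_ge (r + j) p with h | h
  · rw [hi, ← Nat.cast_add, ← concat_apply hp g t h]
    congr 1
    push_cast
    ring
  · have hlt : r + j - p < n := by omega
    have hcommon : g (t + 1) (r + j - p : ℕ) = g t (r + j - p : ℕ) := by
      simpa [subword] using congrFun ((hu _ (hg (t + 1))).trans (hu _ (hg t)).symm) ⟨_, hlt⟩
    have hshift := hper _ (hg t) ((r + j - p : ℕ) : ℤ)
    rw [show ((r + j - p : ℕ) : ℤ) + p = r + j by omega] at hshift
    rw [hshift, ← hcommon, ← concat_apply hp g (t + 1) (by omega : r + j - p < p), hi]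
    congr 1
    rw [add_mul]
    omega

variable [Finite A] {ω : (Fin n → A) → Bool} {Z : Finset (ℤ → A)} {u : Fin n → A}

/-- Periodic points of `X_ω` with a common window can be concatenated freely. -/
lemma card_pow_le_ncard_wordsOf
    (hX : ∀ x : ℤ → A, (∀ i, subword x i n ∈ wordsOf X n) → x ∈ X) (hp : 0 < p) (hnp : n ≤ p)
    (hZ : Z.Nonempty) (hZX : ∀ z ∈ Z, z ∈ XRes X ω)
    (hper : ∀ z ∈ Z, Function.Periodic z (p : ℤ)) (hu : ∀ z ∈ Z, subword z 0 n = u) (k : ℕ) :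
    Z.card ^ k ≤ (wordsOf (XRes X ω) (k * p)).ncard := by
  obtain ⟨z₀, hz₀⟩ := hZ
  let ext : (Fin k → ℤ → A) → ℤ → ℤ → A := fun f t =>
    if h : t.toNat < k then f ⟨t.toNat, h⟩ else z₀
  have hext : ∀ f ∈ Fintype.piFinset fun _ : Fin k => Z, ∀ t, ext f t ∈ (Z : Set (ℤ → A)) := by
    intro f hf t
    simp only [ext]
    split_ifs
    · exact Fintype.mem_piFinset.1 hf _
    · exact hz₀
  have hcard : (Fintype.piFinset fun _ : Fin k => Z).card = Z.card ^ k := by simp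
  rw [← hcard, ← Set.ncard_coe_finset]
  refine Set.ncard_le_ncard_of_injOn (fun f => subword (concat p (ext f)) 0 (k * p)) ?_ ?_
    (Set.toFinite _)
  · intro f hf
    suffices concat p (ext f) ∈ XRes X ω from subword_mem_wordsOf this 0 _
    refine ⟨hX _ fun i => ?_, fun i => ?_⟩ <;>
      obtain ⟨z, hz, r, hr⟩ := subword_concat hp hnp hper hu (hext f hf) i <;> rw [hr]
    · exact subword_mem_wordsOf (hZX z hz).1 r n
    · exact (hZX z hz).2 r
  · intro f hf f' hf' h
    funext t
    have hft := Fintype.mem_piFinset.1 hf t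
    have hft' := Fintype.mem_piFinset.1 hf' t
    refine AgreeBelow.eq_of_periodic hp.ne' (hper _ hft) (hper _ hft') fun j hj => ?_
    have hlt : t * p + j < k * p := by
      calc t * p + j < t * p + p := by omega
        _ = (t + 1) * p := by ring
        _ ≤ k * p := Nat.mul_le_mul_right p t.2
    have := congrFun h ⟨_, hlt⟩
    simp only [subword, zero_add, Nat.cast_add, Nat.cast_mul] at this
    rw [concat_apply hp _ _ hj, concat_apply hp _ _ hj] at this
    simpa [ext] using this

lemma log_card_div_le_subEntropy
    (hX : ∀ x : ℤ → A, (∀ i, subword x i n ∈ wordsOf X n) → x ∈ X) (hp : 0 < p) (hnp : n ≤ p)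
    (hZ : Z.Nonempty) (hZX : ∀ z ∈ Z, z ∈ XRes X ω)
    (hper : ∀ z ∈ Z, Function.Periodic z (p : ℤ)) (hu : ∀ z ∈ Z, subword z 0 n = u) :
    Real.log Z.card / p ≤ subEntropy (XRes X ω) := by
  refine le_ciInf fun m => ?_
  have h : (Z.card : ℝ) ^ (m + 1) ≤ ((wordsOf (XRes X ω) (m + 1)).ncard : ℝ) ^ p := by
    exact_mod_cast (card_pow_le_ncard_wordsOf hX hp hnp hZ hZX hper hu (m + 1)).trans
      (ncard_wordsOf_mul_le _ _ p)
  have hpos : (0 : ℝ) < Z.card := by exact_mod_cast hZ.card_pos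
  have hlog := Real.log_le_log (by positivity) h
  rw [Real.log_pow, Real.log_pow] at hlog
  have hp' : (0 : ℝ) < p := by exact_mod_cast hp
  rw [div_le_div_iff₀ hp' (by positivity)]
  push_cast at hlog
  linarith

end Entropy

section RandomSubshift

lemma survivors_eq_card {E ι : Type*} [Fintype E] [DecidableEq E] (P : Finset ι) (W : ι → Finset E)
    (ω : E → Bool) : survivors P W ω = ({y ∈ P | ∀ e ∈ W y, ω e = true}.card : ℝ) := by
  rw [survivors, Finset.sum_boole]

variable {A : Type*} [DecidableEq A] {X : Set (ℤ → A)} {n p : ℕ} {K μ α κ : ℝ}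

lemma mem_windows_of_periodic (hp : 0 < p) {y : ℤ → A} (hy : Function.Periodic y (p : ℤ))
    {w : Fin n → A} : w ∈ windows n p y ↔ ∃ i : ℤ, subword y i n = w := by
  have hp' : (p : ℤ) ≠ 0 := by omega
  simp only [windows, Finset.mem_image, Finset.mem_range]
  constructor
  · rintro ⟨j, -, h⟩
    exact ⟨j, h⟩
  · rintro ⟨i, rfl⟩
    have h0 := Int.emod_nonneg i hp'
    have h1 := Int.emod_lt_of_pos i (by omega : (0 : ℤ) < p)
    refine ⟨(i % p).toNat, by omega, funext fun k => ?_⟩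
    rw [Int.toNat_of_nonneg h0, subword, subword, ← apply_emod_of_periodic hy,
      Int.emod_add_emod, apply_emod_of_periodic hy]

lemma windows_translate (hp : 0 < p) {y : ℤ → A} (hy : Function.Periodic y (p : ℤ)) (k : ℤ) :
    windows n p (fun i => y (i + k)) = windows n p y := by
  have hy' : Function.Periodic (fun i => y (i + k)) (p : ℤ) := fun i => by
    simpa only [add_right_comm] using hy (i + k)
  have hsub : ∀ i, subword (fun i => y (i + k)) i n = subword y (i + k) n := fun i => by
    funext j
    simp only [subword, add_right_comm]
  ext w
  rw [mem_windows_of_periodic hp hy', mem_windows_of_periodic hp hy]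
  constructor
  · rintro ⟨i, hi⟩
    exact ⟨i + k, by rw [← hi, hsub]⟩
  · rintro ⟨i, hi⟩
    exact ⟨i - k, by rw [← hi, hsub, sub_add_cancel]⟩

variable [Fintype A]

/-- First moment bound for the number of words of length `s * n` in `X_ω`. -/
lemma bprob_le_ncard_wordsOf_le (hX : IsSFT X) (hK : 1 ≤ K) (hμ : 0 < μ)
    (hB : ∀ k, ((wordsOf X k).ncard : ℝ) ≤ K * μ ^ k) (hα0 : 0 < α) (hα1 : α ≤ 1)
    (hαμ : 1 ≤ α * μ) (hn : 0 < n) {s : ℕ} (hs : 0 < s)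
    (hκ : K * (1 + (s * n : ℕ) * (s * n : ℕ)) ≤ κ) {c : ℝ} (hc : 0 < c) :
    bprob α {ω : (Fin n → A) → Bool | c ≤ (wordsOf (XRes X ω) (s * n)).ncard} ≤
      κ ^ (s + 1) * (α * μ) ^ (s * n) * (1 / α) ^ n / c := by
  obtain ⟨P, hPX, hPinj, hP⟩ := hX.exists_finset_represents (s * n)
  set m := s * n
  have hnm : n ≤ m := Nat.le_mul_of_pos_left n hs
  set q := m - n + 1
  have hqm : q ≤ m := by omega
  have hK0 : 0 < K := by linarith
  have hκ0 : 0 ≤ κ := le_trans (by positivity) hκ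
  have hκ' : K * (1 + q * ((∅ : Finset (Fin n → A)).card + q)) ≤ κ := by
    refine le_trans ?_ hκ
    rw [Finset.card_empty, Nat.cast_zero, zero_add]
    gcongr
  have hE := sum_pow_card_windows_sdiff_le hK hμ hB hα0 hα1 hαμ hPX hqm hPinj hκ' (s := s) le_rfl
  simp only [Finset.sdiff_empty] at hE
  refine (bprob_le_expectation_div hα0.le hα1 hc (survivors P (windows n q)) ?_ ?_).trans ?_
  · intro ω
    rw [survivors_eq_card]
    exact Nat.cast_nonneg _
  · intro ω hω
    refine le_trans hω ?_
    rw [survivors_eq_card]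
    norm_cast
    refine le_trans (Set.ncard_le_ncard ?_ (Set.toFinite _))
      ((Set.ncard_coe_finset (Finset.image (fun x : ℤ → A => subword x 0 m)
        {y ∈ P | ∀ e ∈ windows n q y, ω e = true})).trans_le Finset.card_image_le)
    rintro w ⟨x, hx, i, hi⟩
    obtain ⟨y, hy, hyw⟩ := hP w ⟨x, hx.1, i, hi⟩
    rw [Finset.mem_coe, Finset.mem_image]
    refine ⟨y, Finset.mem_filter.2 ⟨hy, fun e he => ?_⟩, hyw⟩
    obtain ⟨j, hj, rfl⟩ := Finset.mem_image.1 he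
    rw [← hx.2 (i + j)]
    congr 1
    funext k
    have hjk : j + k < m := by have := Finset.mem_range.1 hj; omega
    have h1 := hi ⟨j + k, hjk⟩
    rw [← hyw] at h1
    simp only [subword, zero_add, Nat.cast_add] at h1 ⊢
    rw [← h1, add_assoc]
  · rw [expectation_survivors]
    gcongr
    refine hE.trans ?_
    gcongr
    · exact (one_le_div hα0).2 hα1
    · omega

/-- Second moment bound for the number of periodic points of `X` surviving in `X_ω`. -/
lemma sum_pow_card_windows_union_le (hX : IsSFT X) (hK : 1 ≤ K) (hμ : 0 < μ)
    (hB : ∀ k, ((wordsOf X k).ncard : ℝ) ≤ K * μ ^ k) (hα0 : 0 < α) (hα1 : α ≤ 1)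
    (hαμ : 1 ≤ α * μ) (hp : 0 < p) {P : Finset (ℤ → A)} (hP : ∀ x, x ∈ P ↔ x ∈ perPts X p)
    {s : ℕ} (hs : p ≤ s * n) (hκ : K * (1 + p * (p + p)) ≤ κ) :
    ∑ x ∈ P, ∑ y ∈ P with ¬ Disjoint (windows n p x) (windows n p y),
      α ^ (windows n p x ∪ windows n p y).card ≤
        κ ^ (s + 1) * (α * μ) ^ p * (p * (p * (κ ^ (s + 1) * (α * μ) ^ (p - n)))) := by
  have hK0 : 0 < K := by linarith
  have hκ0 : 0 ≤ κ := le_trans (by positivity) hκ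
  have hPX : ∀ x ∈ P, x ∈ X := fun x hx => ((hP x).1 hx).1
  have hper : ∀ x ∈ P, Function.Periodic x (p : ℤ) := fun x hx => ((hP x).1 hx).2
  have hinj : ∀ x ∈ P, ∀ y ∈ P, AgreeBelow p x y → x = y := fun x hx y hy h =>
    h.eq_of_periodic hp.ne' (hper x hx) (hper y hy)
  have hκV : ∀ V : Finset (Fin n → A), V.card ≤ p → K * (1 + p * (V.card + p)) ≤ κ := by
    intro V hV
    refine le_trans ?_ hκ
    gcongr
  have hdiag := sum_pow_card_windows_sdiff_le hK hμ hB hα0 hα1 hαμ hPX le_rfl hinj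
    (hκV ∅ (by simp)) hs
  simp only [Finset.sdiff_empty, Nat.sub_self, pow_zero, mul_one] at hdiag
  have htranslate : ∀ (V : Finset (Fin n → A)) (j : ℕ),
      ∑ y ∈ P with subword y j n ∈ V, α ^ (windows n p y \ V).card ≤
        ∑ y ∈ P with subword y 0 n ∈ V, α ^ (windows n p y \ V).card := by
    intro V j
    have hτ : Function.Injective fun (y : ℤ → A) (i : ℤ) => y (i + j) := fun y y' h => by
      funext i
      simpa using congrFun h (i - j)
    calc _ = ∑ y ∈ P with subword y j n ∈ V,
          α ^ (windows n p (fun i => y (i + j)) \ V).card := by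
          refine Finset.sum_congr rfl fun y hy => ?_
          rw [windows_translate hp (hper y (Finset.mem_filter.1 hy).1)]
      _ = ∑ y ∈ {y ∈ P | subword y j n ∈ V}.image fun (y : ℤ → A) (i : ℤ) => y (i + j),
          α ^ (windows n p y \ V).card := by
          rw [Finset.sum_image fun _ _ _ _ h => hτ h]
      _ ≤ _ := by
          refine Finset.sum_le_sum_of_subset_of_nonneg ?_ fun _ _ _ => by positivity
          intro z hz
          obtain ⟨y, hy, rfl⟩ := Finset.mem_image.1 hz
          rw [Finset.mem_filter] at hy ⊢
          refine ⟨(hP _).2 ⟨hX.translate_mem (hPX y hy.1) j, fun i => ?_⟩, ?_⟩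
          · simpa only [add_right_comm] using hper y hy.1 (i + j)
          · convert hy.2 using 1
            funext k
            simp only [subword, zero_add, add_comm (j : ℤ)]
  have hrow : ∀ x ∈ P, ∑ y ∈ P with ¬ Disjoint (windows n p x) (windows n p y),
      α ^ (windows n p y \ windows n p x).card ≤
        p * (p * (κ ^ (s + 1) * (α * μ) ^ (p - n))) := by
    intro x _
    have hcard : (windows n p x).card ≤ p :=
      Finset.card_image_le.trans_eq (Finset.card_range p)
    set V := windows n p x
    have hg : ∀ y : ℤ → A, 0 ≤ α ^ (windows n p y \ V).card := fun y => by positivity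
    calc _ ≤ ∑ y ∈ (Finset.range p).biUnion fun j => {y ∈ P | subword y (j : ℕ) n ∈ V},
          α ^ (windows n p y \ V).card := by
          refine Finset.sum_le_sum_of_subset_of_nonneg ?_ fun y _ _ => hg y
          intro y hy
          rw [Finset.mem_filter, Finset.not_disjoint_iff] at hy
          obtain ⟨hyP, w, hw, hwy⟩ := hy
          obtain ⟨j, hj, rfl⟩ := Finset.mem_image.1 hwy
          exact Finset.mem_biUnion.2 ⟨j, hj, Finset.mem_filter.2 ⟨hyP, hw⟩⟩
      _ ≤ ∑ j ∈ Finset.range p, ∑ y ∈ P with subword y (j : ℕ) n ∈ V,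
          α ^ (windows n p y \ V).card := sum_biUnion_le_sum hg _ _
      _ ≤ ∑ j ∈ Finset.range p, (p : ℝ) * (κ ^ (s + 1) * (α * μ) ^ (p - n)) := by
          refine Finset.sum_le_sum fun j _ => (htranslate V j).trans ?_
          have h := sum_pow_card_windows_sdiff_le_of_mem hK hμ hB hα0 hα1 hαμ hPX le_rfl hinj
            (hκV V hcard) hs
          rw [Nat.sub_self, pow_zero, mul_one] at h
          refine h.trans ?_
          gcongr
      _ = _ := by rw [Finset.sum_const, Finset.card_range, nsmul_eq_mul]
  calc _ = ∑ x ∈ P, α ^ (windows n p x).card *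
        ∑ y ∈ P with ¬ Disjoint (windows n p x) (windows n p y),
          α ^ (windows n p y \ windows n p x).card := by
        refine Finset.sum_congr rfl fun x _ => ?_
        rw [Finset.mul_sum]
        refine Finset.sum_congr rfl fun y _ => ?_
        rw [← pow_add, Finset.union_comm, ← Finset.card_sdiff_add_card, add_comm]
    _ ≤ ∑ x ∈ P, α ^ (windows n p x).card *
        (p * (p * (κ ^ (s + 1) * (α * μ) ^ (p - n)))) :=
        Finset.sum_le_sum fun x hx => mul_le_mul_of_nonneg_left (hrow x hx) (by positivity)
    _ ≤ _ := by
        rw [← Finset.sum_mul]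
        gcongr

/-- If many periodic points survive, then `X_ω` has large entropy. -/
lemma entropy_ge_of_le_survivors
    (hX : ∀ x : ℤ → A, (∀ i, subword x i n ∈ wordsOf X n) → x ∈ X) (hp : 0 < p) (hnp : n ≤ p)
    {P : Finset (ℤ → A)} (hP : ∀ x, x ∈ P ↔ x ∈ perPts X p) {ω : (Fin n → A) → Bool} {c : ℝ}
    (hc : 0 < c) (hω : c ≤ survivors P (windows n p) ω) :
    (XRes X ω).Nonempty ∧
      (Real.log c - Real.log ((wordsOf X n).ncard)) / p ≤ subEntropy (XRes X ω) := by
  rw [survivors_eq_card] at hω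
  set S := {y ∈ P | ∀ e ∈ windows n p y, ω e = true}
  have hS : ∀ y ∈ S, y ∈ XRes X ω ∧ Function.Periodic y (p : ℤ) := by
    intro y hy
    obtain ⟨hyP, hyω⟩ := Finset.mem_filter.1 hy
    have hyp := (hP y).1 hyP
    exact ⟨⟨hyp.1, fun i => hyω _ ((mem_windows_of_periodic hp hyp.2).2 ⟨i, rfl⟩)⟩, hyp.2⟩
  have hSne : S.Nonempty := by
    rw [← Finset.card_pos]
    exact_mod_cast hc.trans_le hω
  refine ⟨⟨_, (hS _ hSne.choose_spec).1⟩, ?_⟩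
  obtain ⟨u, hu, hmax⟩ := Finset.exists_max_image (S.image fun y => subword y 0 n)
    (fun u => {y ∈ S | subword y 0 n = u}.card) (hSne.image _)
  set Z := {y ∈ S | subword y 0 n = u}
  have hZ : Z.Nonempty := by
    obtain ⟨y, hy, hyu⟩ := Finset.mem_image.1 hu
    exact ⟨y, Finset.mem_filter.2 ⟨hy, hyu⟩⟩
  have himage : (S.image fun y => subword y 0 n).card ≤ (wordsOf X n).ncard := by
    rw [← Set.ncard_coe_finset]
    refine Set.ncard_le_ncard ?_ (Set.toFinite _)
    intro w hw
    obtain ⟨y, hy, rfl⟩ := Finset.mem_image.1 (Finset.mem_coe.1 hw)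
    exact subword_mem_wordsOf (hS y hy).1.1 0 n
  have hcard : c ≤ Z.card * (wordsOf X n).ncard := by
    refine hω.trans ?_
    exact_mod_cast (Finset.card_le_mul_card_image S Z.card hmax).trans
      (Nat.mul_le_mul_left _ himage)
  have hZpos : (0 : ℝ) < Z.card := by exact_mod_cast hZ.card_pos
  have hBpos : (0 : ℝ) < (wordsOf X n).ncard := by
    by_contra h
    nlinarith
  refine le_trans ?_ (log_card_div_le_subEntropy (ω := ω) hX hp hnp hZ
    (fun z hz => (hS z (Finset.mem_filter.1 hz).1).1)
    (fun z hz => (hS z (Finset.mem_filter.1 hz).1).2) fun z hz => (Finset.mem_filter.1 hz).2)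
  gcongr
  rw [sub_le_iff_le_add, ← Real.log_mul hZpos.ne' hBpos.ne']
  exact Real.log_le_log hc hcard

lemma bprob_le_of_ncard_perPts_ge (hX : IsSFT X)
    (hXn : ∀ x : ℤ → A, (∀ i, subword x i n ∈ wordsOf X n) → x ∈ X) (hK : 1 ≤ K) (hμ : 0 < μ)
    (hB : ∀ k, ((wordsOf X k).ncard : ℝ) ≤ K * μ ^ k) (hα0 : 0 < α) (hα1 : α ≤ 1)
    (hαμ : 1 ≤ α * μ) (hp : 0 < p) (hnp : n ≤ p) {s : ℕ} (hs : p ≤ s * n)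
    (hκ : K * (1 + p * (p + p)) ≤ κ) {ν : ℝ} (hν : 0 < ν) (hper : ν ^ p ≤ (perPts X p).ncard)
    {r : ℝ} (hr : r * p < Real.log ((α * ν) ^ p / 2) - Real.log (K * μ ^ n)) :
    bprob α {ω : (Fin n → A) → Bool | XRes X ω = ∅ ∨ subEntropy (XRes X ω) ≤ r} ≤
      4 * (κ ^ (s + 1) * (α * μ) ^ p * (p * (p * (κ ^ (s + 1) * (α * μ) ^ (p - n))))) /
        ((α * ν) ^ p) ^ 2 := by
  have hp' : (0 : ℝ) < p := by exact_mod_cast hp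
  have hκ0 : 0 ≤ κ := le_trans (by positivity) hκ
  set P := (finite_perPts X hp.ne').toFinset with hPdef
  have hP : ∀ x, x ∈ P ↔ x ∈ perPts X p := fun x => Set.Finite.mem_toFinset _
  set m := ∑ y ∈ P, α ^ (windows n p y).card with hm
  have hmge : (α * ν) ^ p ≤ m := by
    calc (α * ν) ^ p = ν ^ p * α ^ p := by rw [mul_pow, mul_comm]
      _ ≤ P.card * α ^ p := by
          gcongr
          rwa [hPdef, ← Set.ncard_eq_toFinset_card _ (finite_perPts X hp.ne')]
      _ ≤ m := by
          rw [← nsmul_eq_mul]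
          refine Finset.card_nsmul_le_sum _ _ _ fun y _ => ?_
          exact pow_le_pow_of_le_one hα0.le hα1
            (Finset.card_image_le.trans_eq (Finset.card_range p))
  have hαν0 : 0 < (α * ν) ^ p := by positivity
  have hm0 : 0 < m := hαν0.trans_le hmge
  have hsub : {ω : (Fin n → A) → Bool | XRes X ω = ∅ ∨ subEntropy (XRes X ω) ≤ r} ⊆
      {ω | survivors P (windows n p) ω < m / 2} := by
    intro ω hω
    rw [Set.mem_ofPred_eq] at hω ⊢
    by_contra! hcon
    obtain ⟨hne, hle⟩ := entropy_ge_of_le_survivors hXn hp hnp hP (by positivity) hcon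
    have h2 := hle.trans (hω.resolve_left hne.ne_empty)
    rw [div_le_iff₀ hp'] at h2
    have h3 : Real.log ((α * ν) ^ p / 2) ≤ Real.log (m / 2) :=
      Real.log_le_log (by positivity) (by linarith)
    have h4 : Real.log ((wordsOf X n).ncard) ≤ Real.log (K * μ ^ n) := by
      have hμ1 : 1 ≤ μ := hαμ.trans (mul_le_of_le_one_left hμ.le hα1)
      rcases (Nat.cast_nonneg (α := ℝ) (wordsOf X n).ncard).eq_or_lt with h | h
      · rw [← h, Real.log_zero]
        exact Real.log_nonneg (one_le_mul_of_one_le_of_one_le hK (one_le_pow₀ hμ1))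
      · exact Real.log_le_log h (hB n)
    linarith
  refine (bprob_mono hα0.le hα1 hsub).trans ((bprob_survivors_lt_half P (windows n p) hα0.le hα1
    hm.symm hm0 (sum_pow_card_windows_union_le hX hK hμ hB hα0 hα1 hαμ hp hP hs hκ)).trans ?_)
  have hαμ0 : 0 < α * μ := by positivity
  gcongr

end RandomSubshift

section Tails

lemma eventually_mul_pow_le_exp (a : ℝ) (d : ℕ) {c : ℝ} (hc : 0 < c) :
    ∀ᶠ n : ℕ in atTop, a * (n : ℝ) ^ d ≤ Real.exp (c * n) := by
  have h := ((isLittleO_pow_exp_pos_mul_atTop d hc).const_mul_left a).bound one_pos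
  filter_upwards [tendsto_natCast_atTop_atTop.eventually h] with n hn
  rw [one_mul, Real.norm_of_nonneg (Real.exp_pos _).le] at hn
  exact (Real.le_norm_self _).trans hn

variable {A : Type*} [Fintype A] [DecidableEq A] {X : Set (ℤ → A)} {lam α ε : ℝ}

/-- The entropy of `X_ω` is unlikely to be much larger than `log (α * lam)`. -/
lemma IsSFT.exists_bprob_upper_tail_le (hX : IsSFT X) (hlam : 1 < lam)
    (hent : Tendsto (fun n : ℕ => Real.log ((wordsOf X n).ncard) / (n : ℝ)) atTop
      (𝓝 (Real.log lam))) (hα0 : 1 / lam < α) (hα1 : α ≤ 1) (hε : 0 < ε) :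
    ∃ ρ : ℝ, 0 < ρ ∧ ∀ᶠ n : ℕ in atTop,
      bprob α {ω : (Fin n → A) → Bool | Real.log (α * lam) + ε ≤ subEntropy (XRes X ω)} ≤
        Real.exp (-ρ * n) := by
  have hlam0 : 0 < lam := by linarith
  have hα : 0 < α := lt_trans (by positivity) hα0
  have hβ : 1 < α * lam := (div_lt_iff₀ hlam0).1 hα0
  set L := Real.log (α * lam) with hLdef
  have hL : 0 < L := Real.log_pos hβ
  set μ := lam * Real.exp (ε / 2) with hμdef
  have hμ : lam < μ := lt_mul_of_one_lt_right hlam0 (Real.one_lt_exp_iff.2 (by linarith))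
  have hμ0 : 0 < μ := hlam0.trans hμ
  have hαμ : α * μ = Real.exp (L + ε / 2) := by
    rw [Real.exp_add, hLdef, Real.exp_log (by positivity), hμdef, mul_assoc]
  have hαμ1 : 1 ≤ α * μ := by
    rw [hαμ]
    exact Real.one_le_exp (by linarith)
  obtain ⟨K, hK, hB⟩ := exists_ncard_wordsOf_le hlam hent hμ
  have ha : 0 ≤ Real.log (1 / α) := Real.log_nonneg ((one_le_div hα).2 hα1)
  obtain ⟨s, hs⟩ := exists_nat_gt (2 * (1 + Real.log (1 / α)) / ε)
  have hs0 : 0 < s := by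
    have : (0 : ℝ) < s := lt_of_le_of_lt (by positivity) hs
    exact_mod_cast this
  rw [div_lt_iff₀ hε] at hs
  refine ⟨1 / 2, by norm_num, ?_⟩
  filter_upwards [eventually_mul_pow_le_exp ((K * (1 + s * s)) ^ (s + 1)) (2 * (s + 1))
    (one_half_pos (α := ℝ)), eventually_gt_atTop 0] with n hpoly hn
  have hn1 : (1 : ℝ) ≤ n := by exact_mod_cast hn
  set κ := K * (1 + (s * n : ℕ) * (s * n : ℕ)) with hκ
  have hκpow : κ ^ (s + 1) ≤ Real.exp (1 / 2 * n) := by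
    refine le_trans ?_ hpoly
    rw [pow_mul, ← mul_pow]
    have : κ ≤ K * (1 + s * s) * (n : ℝ) ^ 2 := by
      rw [hκ, mul_assoc]
      push_cast
      gcongr
      nlinarith
    gcongr
  have hm : 0 < s * n := Nat.mul_pos hs0 hn
  have hm' : (0 : ℝ) < (s * n : ℕ) := by exact_mod_cast hm
  set c := Real.exp ((s * n : ℕ) * (L + ε)) with hc
  have hsub : {ω : (Fin n → A) → Bool | L + ε ≤ subEntropy (XRes X ω)} ⊆
      {ω | c ≤ (wordsOf (XRes X ω) (s * n)).ncard} := by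
    intro ω hω
    have h := le_trans hω (subEntropy_le (XRes X ω) hm)
    rw [le_div_iff₀ hm', mul_comm] at h
    rcases (Nat.cast_nonneg (α := ℝ) (wordsOf (XRes X ω) (s * n)).ncard).eq_or_lt with h0 | h0
    · rw [← h0, Real.log_zero] at h
      have : 0 < ((s * n : ℕ) : ℝ) * (L + ε) := by positivity
      linarith
    · exact (Real.le_log_iff_exp_le h0).1 h
  refine (bprob_mono hα.le hα1 hsub).trans ((bprob_le_ncard_wordsOf_le hX hK hμ0 hB hα hα1 hαμ1 hn
    hs0 le_rfl (Real.exp_pos _)).trans ?_)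
  rw [div_le_iff₀ (Real.exp_pos _)]
  calc κ ^ (s + 1) * (α * μ) ^ (s * n) * (1 / α) ^ n
      ≤ Real.exp (1 / 2 * n) * (α * μ) ^ (s * n) * (1 / α) ^ n := by gcongr
    _ = Real.exp (1 / 2 * n + (s * n : ℕ) * (L + ε / 2) + n * Real.log (1 / α)) := by
        rw [Real.exp_add, Real.exp_add (1 / 2 * (n : ℝ)), Real.exp_nat_mul, Real.exp_nat_mul,
          Real.exp_log (by positivity), hαμ]
    _ ≤ Real.exp (-(1 / 2) * n + (s * n : ℕ) * (L + ε)) := by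
        rw [Real.exp_le_exp]
        push_cast
        nlinarith
    _ = _ := Real.exp_add _ _

/-- It is unlikely that `X_ω` is empty or has entropy much smaller than `log (α * lam)`. -/
lemma IsSFT.exists_bprob_lower_tail_le (hX : IsSFT X) (hlam : 1 < lam)
    (hent : Tendsto (fun n : ℕ => Real.log ((wordsOf X n).ncard) / (n : ℝ)) atTop
      (𝓝 (Real.log lam))) (hα0 : 1 / lam < α) (hα1 : α ≤ 1) (hε : 0 < ε) :
    ∃ ρ : ℝ, 0 < ρ ∧ ∀ᶠ n : ℕ in atTop,
      bprob α {ω : (Fin n → A) → Bool |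
        XRes X ω = ∅ ∨ subEntropy (XRes X ω) ≤ Real.log (α * lam) - ε} ≤
        Real.exp (-ρ * n) := by
  have hlam0 : 0 < lam := by linarith
  have hα : 0 < α := lt_trans (by positivity) hα0
  have hβ : 1 < α * lam := (div_lt_iff₀ hlam0).1 hα0
  set L := Real.log (α * lam) with hLdef
  have hL : 0 < L := Real.log_pos hβ
  have hlog : 0 < Real.log lam := Real.log_pos hlam
  have hLlog : L ≤ Real.log lam :=
    Real.log_le_log (by positivity) (mul_le_of_le_one_left hlam0.le hα1)
  obtain ⟨C, hC⟩ := exists_nat_gt (2 * (Real.log lam + 2) / ε)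
  rw [div_lt_iff₀ hε] at hC
  set s := C + 1 with hsdef
  have hs1 : (1 : ℝ) ≤ s := by exact_mod_cast Nat.succ_pos C
  obtain ⟨δ, hδ0, hδ1, hδε, hδL⟩ : ∃ δ : ℝ, 0 < δ ∧ δ ≤ 1 ∧ δ ≤ ε / 2 ∧ δ ≤ L / (8 * s) :=
    ⟨min (min 1 (ε / 2)) (L / (8 * s)), by positivity, (min_le_left _ _).trans (min_le_left _ _),
      (min_le_left _ _).trans (min_le_right _ _), min_le_right _ _⟩
  rw [le_div_iff₀ (by positivity)] at hδL
  have hδL' : δ ≤ L := by nlinarith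
  set ν := lam * Real.exp (-δ) with hνdef
  set μ := lam * Real.exp δ with hμdef
  have hν1 : 1 ≤ ν := by
    rw [hνdef, ← Real.exp_log hlam0, ← Real.exp_add]
    exact Real.one_le_exp (by linarith)
  have hνl : ν < lam := mul_lt_of_lt_one_right hlam0 (Real.exp_lt_one_iff.2 (by linarith))
  have hμ : lam < μ := lt_mul_of_one_lt_right hlam0 (Real.one_lt_exp_iff.2 hδ0)
  have hμ0 : 0 < μ := hlam0.trans hμ
  have hαμ : α * μ = Real.exp (L + δ) := by
    rw [Real.exp_add, hLdef, Real.exp_log (by positivity), hμdef, mul_assoc]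
  have hαν : α * ν = Real.exp (L - δ) := by
    rw [sub_eq_add_neg, Real.exp_add, hLdef, Real.exp_log (by positivity), hνdef, mul_assoc]
  have hαμ1 : 1 ≤ α * μ := by
    rw [hαμ]
    exact Real.one_le_exp (by linarith)
  obtain ⟨K, hK, hB⟩ := exists_ncard_wordsOf_le hlam hent hμ
  obtain ⟨D, hD, hper⟩ := hX.exists_le_ncard_perPts hent hν1 hνl
  obtain ⟨M₀, hM₀⟩ := hX.exists_mem_of_subword_mem
  refine ⟨L / 4, by positivity, ?_⟩
  filter_upwards [eventually_mul_pow_le_exp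
      (4 * ((3 * K * s ^ 2) ^ (s + 1) * (3 * K * s ^ 2) ^ (s + 1)) * s ^ 2)
      (2 * (s + 1) + 2 * (s + 1) + 2) (by positivity : 0 < L / 4),
    eventually_gt_atTop 0, eventually_ge_atTop D, eventually_ge_atTop M₀,
    tendsto_natCast_atTop_atTop.eventually_gt_atTop (Real.log 2 + Real.log K)]
    with n hpoly hn hnD hnM hnK
  have hn1 : (1 : ℝ) ≤ n := by exact_mod_cast hn
  set p := D * (C * n / D + 1) with hpdef
  have hp0 : 0 < p := Nat.mul_pos hD (Nat.succ_pos _)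
  have hCp : C * n < p := Nat.lt_mul_div_succ _ hD
  have hps : p ≤ s * n := by
    have := Nat.mul_div_le (C * n) D
    rw [hpdef, hsdef, mul_add, add_mul]
    omega
  have hC1 : 1 ≤ C := by
    have h : (0 : ℝ) < C := by
      by_contra h
      nlinarith
    exact_mod_cast h
  have hnp : n ≤ p := (Nat.le_mul_of_pos_left n hC1).trans hCp.le
  have hp0' : (0 : ℝ) < p := by exact_mod_cast hp0
  have hCp' : (C : ℝ) * n ≤ p := by exact_mod_cast hCp.le
  have hps' : (p : ℝ) ≤ s * n := by exact_mod_cast hps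
  set κ := K * (1 + p * (p + p)) with hκdef
  have hκ : κ ≤ 3 * K * s ^ 2 * (n : ℝ) ^ 2 := by
    have h1 : (1 : ℝ) ≤ s * n := one_le_mul_of_one_le_of_one_le hs1 hn1
    calc κ ≤ K * (s * n * (s * n) + s * n * (s * n + s * n)) := by
          rw [hκdef]
          gcongr
          nlinarith
      _ = _ := by ring
  have hκ0 : 0 ≤ κ := by positivity
  have hαν0 : 0 < (α * ν) ^ p := by
    rw [hαν]
    positivity
  have hgap : (L - ε) * p < Real.log ((α * ν) ^ p / 2) - Real.log (K * μ ^ n) := by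
    have h1 : Real.log (K * μ ^ n) = Real.log K + n * (Real.log lam + δ) := by
      rw [Real.log_mul (by positivity) (by positivity), Real.log_pow, hμdef,
        Real.log_mul hlam0.ne' (Real.exp_pos _).ne', Real.log_exp]
    have h2 : (n : ℝ) * (Real.log lam + δ + 1) ≤ p * (ε - δ) := by
      calc (n : ℝ) * (Real.log lam + δ + 1) ≤ n * (C * ε / 2) := by
            gcongr
            linarith
        _ = C * n * (ε / 2) := by ring
        _ ≤ p * (ε - δ) := by
          gcongr
          linarith
    rw [h1, Real.log_div hαν0.ne' two_ne_zero, Real.log_pow, hαν, Real.log_exp]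
    linarith
  refine (bprob_le_of_ncard_perPts_ge hX (hM₀ n hnM) hK hμ0 hB hα hα1 hαμ1 hp0 hnp hps le_rfl
    (by linarith) (hper _ (Nat.succ_pos _)) hgap).trans ?_
  rw [← hκdef, div_le_iff₀ (by positivity)]
  have hκpoly : 4 * (κ ^ (s + 1) * κ ^ (s + 1)) * (p : ℝ) ^ 2 ≤ Real.exp (L / 4 * n) := by
    refine le_trans ?_ hpoly
    calc 4 * (κ ^ (s + 1) * κ ^ (s + 1)) * (p : ℝ) ^ 2
        ≤ 4 * ((3 * K * s ^ 2 * (n : ℝ) ^ 2) ^ (s + 1) * (3 * K * s ^ 2 * (n : ℝ) ^ 2) ^ (s + 1)) *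
          (s * n) ^ 2 := by gcongr
      _ = _ := by
        rw [mul_pow _ ((n : ℝ) ^ 2), ← pow_mul, mul_pow (s : ℝ), pow_add, pow_add]
        ring
  calc 4 * (κ ^ (s + 1) * (α * μ) ^ p * (p * (p * (κ ^ (s + 1) * (α * μ) ^ (p - n)))))
      = 4 * (κ ^ (s + 1) * κ ^ (s + 1)) * (p : ℝ) ^ 2 *
          ((α * μ) ^ p * (α * μ) ^ (p - n)) := by ring
    _ ≤ Real.exp (L / 4 * n) * ((α * μ) ^ p * (α * μ) ^ (p - n)) := by gcongr
    _ = Real.exp (L / 4 * n + (p * (L + δ) + (p - n : ℕ) * (L + δ))) := by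
        rw [Real.exp_add, Real.exp_add (p * (L + δ)), Real.exp_nat_mul, Real.exp_nat_mul, hαμ]
    _ ≤ Real.exp (-(L / 4) * n + (2 : ℕ) * (p * (L - δ))) := by
        rw [Real.exp_le_exp, Nat.cast_sub hnp]
        push_cast
        have h1 : 4 * (p * δ) ≤ 4 * (s * n * δ) := by gcongr
        have h2 : 4 * (s * n * δ) ≤ L / 2 * n := by
          calc 4 * (s * n * δ) = δ * (8 * s) * (n / 2) := by ring
            _ ≤ L * (n / 2) := by gcongr
            _ = L / 2 * n := by ring
        have h3 : 0 ≤ n * δ := by positivity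
        linarith
    _ = Real.exp (-(L / 4) * n) * ((α * ν) ^ p) ^ 2 := by
        rw [Real.exp_add, Real.exp_nat_mul, Real.exp_nat_mul, hαν]

end Tails

/-- **Theorem 1.3 (Entropy of random SFTs).**  Let `X` be an SFT with positive
entropy `h(X) = log λ`.  Then for `1/λ < α ≤ 1` and `ε > 0`, the probability
that `|h(X_ω) − log (αλ)| ≥ ε` (where an empty `X_ω` has entropy `−∞`, i.e. the
event includes emptiness) tends to `0` as `n → ∞`, exponentially fast in `n`. -/
theorem random_SFT_entropy {A : Type*} [Fintype A] [DecidableEq A]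
    (X : Set (ℤ → A)) (hSFT : IsSFT X)
    (lam : ℝ) (hlam : 1 < lam)
    (hent : Tendsto (fun n : ℕ => Real.log ((wordsOf X n).ncard) / (n : ℝ))
      atTop (𝓝 (Real.log lam)))
    (α : ℝ) (hα0 : 1 / lam < α) (hα1 : α ≤ 1) (ε : ℝ) (hε : 0 < ε) :
    Tendsto
      (fun n : ℕ => bprob α
        {ω : (Fin n → A) → Bool |
          XRes X ω = ∅ ∨ ε ≤ |subEntropy (XRes X ω) - Real.log (α * lam)|})
      atTop (𝓝 0) ∧
    ∃ K : ℝ, 0 < K ∧ ∃ ρ : ℝ, 0 < ρ ∧ ∀ᶠ n : ℕ in atTop,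
      bprob α
        {ω : (Fin n → A) → Bool |
          XRes X ω = ∅ ∨ ε ≤ |subEntropy (XRes X ω) - Real.log (α * lam)|}
        ≤ K * Real.exp (-ρ * n) := by
  have hα : 0 < α := lt_trans (one_div_pos.2 (by linarith)) hα0
  obtain ⟨ρ₁, hρ₁, h₁⟩ := hSFT.exists_bprob_upper_tail_le hlam hent hα0 hα1 hε
  obtain ⟨ρ₂, hρ₂, h₂⟩ := hSFT.exists_bprob_lower_tail_le hlam hent hα0 hα1 hε
  have hρ : 0 < min ρ₁ ρ₂ := lt_min hρ₁ hρ₂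
  have hbound : ∀ᶠ n : ℕ in atTop, bprob α {ω : (Fin n → A) → Bool |
      XRes X ω = ∅ ∨ ε ≤ |subEntropy (XRes X ω) - Real.log (α * lam)|} ≤
        2 * Real.exp (-min ρ₁ ρ₂ * n) := by
    filter_upwards [h₁, h₂] with n hn₁ hn₂
    refine (bprob_le_add hα.le hα1 fun ω hω => ?_).trans ((add_le_add hn₁ hn₂).trans ?_)
    · rcases hω with hω | hω
      · exact Or.inr (Or.inl hω)
      · rcases le_abs.1 hω with h | h
        · exact Or.inl (le_sub_iff_add_le'.1 h)
        · refine Or.inr (Or.inr ?_)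
          linarith
    · rw [two_mul]
      gcongr
      · exact min_le_left _ _
      · exact min_le_right _ _
  refine ⟨squeeze_zero' (.of_forall fun n => bprob_nonneg hα.le hα1 _) hbound ?_,
    2, two_pos, _, hρ, hbound⟩
  have htend : Tendsto (fun n : ℕ => -min ρ₁ ρ₂ * (n : ℝ)) atTop atBot :=
    tendsto_natCast_atTop_atTop.const_mul_atTop_of_neg (neg_neg_of_pos hρ)
  simpa using (Real.tendsto_exp_atBot.comp htend).const_mul 2
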